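/- There exist constants ε₀ > 0 and C > 0 depending only on k such that the following holds (quantitative expansion of the up-down walk, the key step in the Kruskal–Katona theorem for high dimensional expanders). Let 0 < ε ≤ ε₀, let μ be an ε-product probability measure on V = V₁×⋯×V_k, let d ≤ k, let 0 < δ ≤ (200d)^{−2d}, and let f : V → {0,1} be (d,δ)-global. Then ⟨f − T f, f⟩ ≥ (d/(2k))·‖f‖₂² − C·√ε·‖f‖₂², where T = (1/k)·Σ_{i=1}^{k} A_{[k]∖{i}} is the up-down walk operator. -/

import Mathlib

open Finset

namespace GLL

variable {k : ℕ} {V : Fin k → Type} [∀ i, Fintype (V i)] [∀ i, DecidableEq (V i)]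

/-- Expectation of `f` with respect to the (finitely supported) measure `μ`. -/
def expect (μ f : (∀ i, V i) → ℝ) : ℝ := ∑ x, μ x * f x

/-- `μ` is a probability measure. -/
def IsProb (μ : (∀ i, V i) → ℝ) : Prop := (∀ x, 0 ≤ μ x) ∧ ∑ x, μ x = 1

/-- The marginal `μ_S` evaluated at (the `S`-coordinates of) `x`. -/
def marg (μ : (∀ i, V i) → ℝ) (S : Finset (Fin k)) (x : ∀ i, V i) : ℝ :=
  ∑ z, if ∀ i ∈ S, z i = x i then μ z else 0

/-- The link (conditional) measure `μ_x` for `x ∈ V_S`, viewed as a measure on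
full points agreeing with `x` on `S`. -/
noncomputable def cond (μ : (∀ i, V i) → ℝ) (S : Finset (Fin k)) (x z : ∀ i, V i) : ℝ :=
  if ∀ i ∈ S, z i = x i then μ z / marg μ S x else 0

/-- The averaging operator `A_S`: `A_S f (x) = E_{y ∼ μ_{x_S}} [f(x_S, y)]`.
Applied to an `S'`-junta `f`, this is also the operator `A_{S',S}`. -/
noncomputable def Aop (μ : (∀ i, V i) → ℝ) (S : Finset (Fin k)) (f : (∀ i, V i) → ℝ)
    (x : ∀ i, V i) : ℝ :=
  ∑ z, cond μ S x z * f z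

/-- The Efron–Stein component `f^{=S} = ∑_{T ⊆ S} (-1)^{|S∖T|} A_T f`. -/
noncomputable def ES (μ : (∀ i, V i) → ℝ) (S : Finset (Fin k)) (f : (∀ i, V i) → ℝ)
    (x : ∀ i, V i) : ℝ :=
  ∑ T ∈ S.powerset, (-1 : ℝ) ^ (S.card - T.card) * Aop μ T f x

/-- The low-degree part `f^{≤ d} = ∑_{|S| ≤ d} f^{=S}`. -/
noncomputable def lowPart (μ : (∀ i, V i) → ℝ) (d : ℕ) (f : (∀ i, V i) → ℝ)
    (x : ∀ i, V i) : ℝ :=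
  ∑ S ∈ univ.powerset.filter (fun S : Finset (Fin k) => S.card ≤ d), ES μ S f x

/-- The Laplacian `L_S[f] = ∑_{T ⊇ S} f^{=T}`. -/
noncomputable def Lap (μ : (∀ i, V i) → ℝ) (S : Finset (Fin k)) (f : (∀ i, V i) → ℝ)
    (x : ∀ i, V i) : ℝ :=
  ∑ T ∈ univ.powerset.filter (fun T : Finset (Fin k) => S ⊆ T), ES μ T f x

/-- The truncated Laplacian `L_S^{≤d}[f] = ∑_{T ⊇ S, |T| ≤ d} f^{=T}`. -/
noncomputable def LapLe (μ : (∀ i, V i) → ℝ) (d : ℕ) (S : Finset (Fin k))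
    (f : (∀ i, V i) → ℝ) (x : ∀ i, V i) : ℝ :=
  ∑ T ∈ univ.powerset.filter (fun T : Finset (Fin k) => S ⊆ T ∧ T.card ≤ d), ES μ T f x

/-- The influence `I_{S,x}[f] = ‖L_S[f](x,·)‖²_{L²(μ_x)}`. -/
noncomputable def Inf (μ : (∀ i, V i) → ℝ) (S : Finset (Fin k)) (f : (∀ i, V i) → ℝ)
    (x : ∀ i, V i) : ℝ :=
  ∑ z, cond μ S x z * (Lap μ S f z) ^ 2

/-- The truncated influence `I^{≤d}_{S,x}[f] = ‖L_S^{≤d}[f](x,·)‖²_{L²(μ_x)}`. -/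
noncomputable def InfLe (μ : (∀ i, V i) → ℝ) (d : ℕ) (S : Finset (Fin k))
    (f : (∀ i, V i) → ℝ) (x : ∀ i, V i) : ℝ :=
  ∑ z, cond μ S x z * (LapLe μ d S f z) ^ 2

/-- `‖f‖₂²` with respect to `μ`. -/
def normSq (μ f : (∀ i, V i) → ℝ) : ℝ := ∑ x, μ x * (f x) ^ 2

/-- `‖f‖₄⁴` with respect to `μ`. -/
def norm4p4 (μ f : (∀ i, V i) → ℝ) : ℝ := ∑ x, μ x * (f x) ^ 4

/-- `‖f‖₂` with respect to `μ`. -/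
noncomputable def l2norm (μ f : (∀ i, V i) → ℝ) : ℝ := Real.sqrt (normSq μ f)

/-- `‖f‖_∞`: the maximum of `|f|` over the support of `μ`. -/
noncomputable def supNorm (μ f : (∀ i, V i) → ℝ) : ℝ :=
  sSup ((fun x => |f x|) '' {x | 0 < μ x})

/-- Inner product `⟨f, g⟩ = E_{x∼μ}[f(x) g(x)]`. -/
def inner' (μ f g : (∀ i, V i) → ℝ) : ℝ := ∑ x, μ x * (f x * g x)

/-- The pair `{i,j}`-skeleton of `μ` is `ε`-pseudorandom. -/
def PairPseudo (μ : (∀ i, V i) → ℝ) (ε : ℝ) (i j : Fin k) : Prop :=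
  ∀ (f₁ : V i → ℝ) (f₂ : V j → ℝ),
    |expect μ (fun x => f₁ (x i) * f₂ (x j)) -
        expect μ (fun x => f₁ (x i)) * expect μ (fun x => f₂ (x j))| ≤
      ε * Real.sqrt
        ((expect μ (fun x => f₁ (x i) ^ 2) - expect μ (fun x => f₁ (x i)) ^ 2) *
          (expect μ (fun x => f₂ (x j) ^ 2) - expect μ (fun x => f₂ (x j)) ^ 2))

/-- `μ` is an `ε`-product measure: every link of every restriction of size `≤ k - 2`
has `ε`-pseudorandom skeletons. -/
def EpsProduct (μ : (∀ i, V i) → ℝ) (ε : ℝ) : Prop :=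
  ∀ S : Finset (Fin k), S.card ≤ k - 2 → ∀ x, 0 < marg μ S x →
    ∀ i j : Fin k, i ∉ S → j ∉ S → i ≠ j → PairPseudo (cond μ S x) ε i j

/-- `‖f(x,·)‖_{L²(μ_x)}` for `x ∈ V_S`. -/
noncomputable def restrictNorm (μ : (∀ i, V i) → ℝ) (S : Finset (Fin k)) (x : ∀ i, V i)
    (f : (∀ i, V i) → ℝ) : ℝ :=
  Real.sqrt (∑ z, cond μ S x z * (f z) ^ 2)

/-- `f` is `(d, δ)`-global: all restrictions of at most `d` coordinates have
`2`-norm at most `δ`. -/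
def IsGlobal (μ : (∀ i, V i) → ℝ) (d : ℕ) (δ : ℝ) (f : (∀ i, V i) → ℝ) : Prop :=
  ∀ S : Finset (Fin k), S.card ≤ d → ∀ x, 0 < marg μ S x → restrictNorm μ S x f ≤ δ

/-- `f` is an `S`-junta: it depends only on the coordinates in `S`. -/
def Junta (S : Finset (Fin k)) (f : (∀ i, V i) → ℝ) : Prop :=
  ∀ x y, (∀ i ∈ S, x i = y i) → f x = f y

/-- The noise operator `T_ρ f = ∑_{S ⊆ [k]} ρ^{|S|} (1-ρ)^{k-|S|} A_S f`. -/
noncomputable def noiseOp (μ : (∀ i, V i) → ℝ) (ρ : ℝ) (f : (∀ i, V i) → ℝ)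
    (x : ∀ i, V i) : ℝ :=
  ∑ S ∈ (univ : Finset (Fin k)).powerset, ρ ^ S.card * (1 - ρ) ^ (k - S.card) * Aop μ S f x

/-- The up-down walk operator `T = (1/k) ∑_{i=1}^k A_{[k]∖{i}}`. -/
noncomputable def upDown (μ : (∀ i, V i) → ℝ) (f : (∀ i, V i) → ℝ) (x : ∀ i, V i) : ℝ :=
  (1 / (k : ℝ)) * ∑ i : Fin k, Aop μ (univ.erase i) f x

/-- The product measure `μ₁ ⊗ ⋯ ⊗ μ_k`. -/
def prodMeasure (μi : ∀ i, V i → ℝ) : (∀ i, V i) → ℝ := fun x => ∏ i, μi i (x i)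

/-- `f` has degree at most `d`: `f^{=S} = 0` whenever `|S| > d`. -/
def DegLe (μ : (∀ i, V i) → ℝ) (d : ℕ) (f : (∀ i, V i) → ℝ) : Prop :=
  ∀ S : Finset (Fin k), d < S.card → ∀ x, ES μ S f x = 0

/-- `{F S}_{S ⊆ [k]}` is an `(α, ε')`-approximate Efron–Stein decomposition of `f`. -/
noncomputable def ApproxES (μ : (∀ i, V i) → ℝ) (α ε' : ℝ) (f : (∀ i, V i) → ℝ)
    (F : Finset (Fin k) → (∀ i, V i) → ℝ) : Prop :=
  l2norm μ f ≤ α ∧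
    l2norm μ (fun x => f x - ∑ S ∈ (univ : Finset (Fin k)).powerset, F S x) ≤ ε' ∧
    ∀ S : Finset (Fin k), ∃ h : (∀ i, V i) → ℝ,
      l2norm μ h ≤ α ∧ l2norm μ (fun x => ES μ S h x - F S x) ≤ ε'

set_option linter.unusedSectionVars false

/-! ### The weighted `L²` structure -/

/-- Embedding of functions into Euclidean space that turns `l2norm μ` into the norm. -/
noncomputable def emb (μ f : (∀ i, V i) → ℝ) : EuclideanSpace ℝ (∀ i, V i) :=
  WithLp.toLp 2 (fun x => Real.sqrt (μ x) * f x)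

lemma emb_add (μ f g : (∀ i, V i) → ℝ) : emb μ (f + g) = emb μ f + emb μ g := by
  ext x; simp [emb, mul_add]

lemma emb_smul (μ : (∀ i, V i) → ℝ) (c : ℝ) (f : (∀ i, V i) → ℝ) :
    emb μ (c • f) = c • emb μ f := by
  ext x; simp [emb]; ring

lemma inner'_eq_inner {μ : (∀ i, V i) → ℝ} (hμ : IsProb μ) (f g : (∀ i, V i) → ℝ) :
    inner' μ f g = inner ℝ (emb μ g) (emb μ f) := by
  simp only [inner', emb, PiLp.inner_apply, RCLike.inner_apply, conj_trivial]
  refine Finset.sum_congr rfl fun x _ => ?_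
  have := Real.mul_self_sqrt (hμ.1 x)
  linear_combination (-(f x * g x)) * this

lemma normSq_eq_inner' (μ f : (∀ i, V i) → ℝ) : normSq μ f = inner' μ f f := by
  simp [normSq, inner', sq]

lemma normSq_nonneg {μ : (∀ i, V i) → ℝ} (hμ : IsProb μ) (f : (∀ i, V i) → ℝ) :
    0 ≤ normSq μ f :=
  Finset.sum_nonneg fun x _ => mul_nonneg (hμ.1 x) (sq_nonneg _)

lemma l2norm_nonneg (μ f : (∀ i, V i) → ℝ) : 0 ≤ l2norm μ f := Real.sqrt_nonneg _

lemma l2norm_sq {μ : (∀ i, V i) → ℝ} (hμ : IsProb μ) (f : (∀ i, V i) → ℝ) :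
    l2norm μ f ^ 2 = inner' μ f f := by
  rw [l2norm, Real.sq_sqrt (normSq_nonneg hμ f), normSq_eq_inner']

lemma l2norm_eq_norm {μ : (∀ i, V i) → ℝ} (hμ : IsProb μ) (f : (∀ i, V i) → ℝ) :
    l2norm μ f = ‖emb μ f‖ := by
  rw [l2norm, normSq_eq_inner', inner'_eq_inner hμ, real_inner_self_eq_norm_sq,
    Real.sqrt_sq (norm_nonneg _)]

lemma l2norm_add_le {μ : (∀ i, V i) → ℝ} (hμ : IsProb μ) (f g : (∀ i, V i) → ℝ) :
    l2norm μ (f + g) ≤ l2norm μ f + l2norm μ g := by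
  simp only [l2norm_eq_norm hμ, emb_add]; exact norm_add_le _ _

lemma l2norm_smul {μ : (∀ i, V i) → ℝ} (hμ : IsProb μ) (c : ℝ) (f : (∀ i, V i) → ℝ) :
    l2norm μ (c • f) = |c| * l2norm μ f := by
  simp only [l2norm_eq_norm hμ, emb_smul, norm_smul, Real.norm_eq_abs]

lemma l2norm_zero (μ : (∀ i, V i) → ℝ) : l2norm μ 0 = 0 := by
  simp [l2norm, normSq]

lemma l2norm_sum_le {μ : (∀ i, V i) → ℝ} (hμ : IsProb μ) {ι : Type*} (s : Finset ι)
    (F : ι → (∀ i, V i) → ℝ) :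
    l2norm μ (∑ j ∈ s, F j) ≤ ∑ j ∈ s, l2norm μ (F j) :=
  Finset.le_sum_of_subadditive (l2norm μ) (l2norm_zero μ).le (l2norm_add_le hμ) s F

lemma l2norm_sum_le_card {μ : (∀ i, V i) → ℝ} (hμ : IsProb μ) {ι : Type*} (s : Finset ι)
    (F : ι → (∀ i, V i) → ℝ) {c : ℝ} (h : ∀ j ∈ s, l2norm μ (F j) ≤ c) :
    l2norm μ (∑ j ∈ s, F j) ≤ s.card * c :=
  (l2norm_sum_le hμ s F).trans (by simpa using Finset.sum_le_card_nsmul s _ c h)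

lemma abs_inner'_le {μ : (∀ i, V i) → ℝ} (hμ : IsProb μ) (f g : (∀ i, V i) → ℝ) :
    |inner' μ f g| ≤ l2norm μ f * l2norm μ g := by
  rw [inner'_eq_inner hμ, l2norm_eq_norm hμ, l2norm_eq_norm hμ, mul_comm]
  exact abs_real_inner_le_norm _ _

lemma inner'_comm (μ f g : (∀ i, V i) → ℝ) : inner' μ f g = inner' μ g f := by
  simp [inner', mul_comm]

lemma inner'_sub_left (μ f g h : (∀ i, V i) → ℝ) :
    inner' μ (f - g) h = inner' μ f h - inner' μ g h := by
  simp [inner', sub_mul, mul_sub, Finset.sum_sub_distrib]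

lemma inner'_sub_right (μ f g h : (∀ i, V i) → ℝ) :
    inner' μ h (f - g) = inner' μ h f - inner' μ h g := by
  simp [inner', mul_sub, Finset.sum_sub_distrib]

lemma inner'_smul_left (μ : (∀ i, V i) → ℝ) (c : ℝ) (f h : (∀ i, V i) → ℝ) :
    inner' μ (c • f) h = c * inner' μ f h := by
  simp only [inner', Finset.mul_sum, Pi.smul_apply, smul_eq_mul]
  exact Finset.sum_congr rfl fun x _ => by ring

lemma inner'_smul_right (μ : (∀ i, V i) → ℝ) (c : ℝ) (f h : (∀ i, V i) → ℝ) :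
    inner' μ h (c • f) = c * inner' μ h f := by
  rw [inner'_comm, inner'_smul_left, inner'_comm]

lemma inner'_sum_left (μ : (∀ i, V i) → ℝ) {ι : Type*} (s : Finset ι)
    (F : ι → (∀ i, V i) → ℝ) (h : (∀ i, V i) → ℝ) :
    inner' μ (∑ j ∈ s, F j) h = ∑ j ∈ s, inner' μ (F j) h := by
  simp only [inner', Finset.sum_apply, Finset.sum_mul, Finset.mul_sum]
  exact Finset.sum_comm

lemma inner'_sum_right (μ : (∀ i, V i) → ℝ) {ι : Type*} (s : Finset ι)
    (F : ι → (∀ i, V i) → ℝ) (h : (∀ i, V i) → ℝ) :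
    inner' μ h (∑ j ∈ s, F j) = ∑ j ∈ s, inner' μ h (F j) := by
  simp only [inner'_comm μ h, inner'_sum_left]

lemma inner'_mul_left (μ f g h : (∀ i, V i) → ℝ) :
    inner' μ (f * g) h = inner' μ f (g * h) := by
  simp [inner', mul_assoc]

lemma inner'_mono_right {μ : (∀ i, V i) → ℝ} (hμ : IsProb μ) {f g h : (∀ i, V i) → ℝ}
    (hh : ∀ x, 0 ≤ h x) (hfg : ∀ x, μ x ≠ 0 → f x ≤ g x) : inner' μ h f ≤ inner' μ h g := by
  refine Finset.sum_le_sum fun x _ => ?_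
  by_cases hx : μ x = 0
  · simp [hx]
  · exact mul_le_mul_of_nonneg_left (mul_le_mul_of_nonneg_left (hfg x hx) (hh x)) (hμ.1 x)

lemma inner'_congr_right {μ : (∀ i, V i) → ℝ} {f g : (∀ i, V i) → ℝ} (h : (∀ i, V i) → ℝ)
    (hfg : ∀ x, μ x ≠ 0 → f x = g x) : inner' μ h f = inner' μ h g := by
  refine Finset.sum_congr rfl fun x _ => ?_
  by_cases hx : μ x = 0
  · simp [hx]
  · rw [hfg x hx]

lemma l2norm_congr {μ : (∀ i, V i) → ℝ} {f g : (∀ i, V i) → ℝ}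
    (hfg : ∀ x, μ x ≠ 0 → f x = g x) : l2norm μ f = l2norm μ g := by
  rw [l2norm, l2norm]
  congr 1
  refine Finset.sum_congr rfl fun x _ => ?_
  by_cases hx : μ x = 0
  · simp [hx]
  · rw [hfg x hx]

lemma l2norm_mul_le {μ : (∀ i, V i) → ℝ} (hμ : IsProb μ) (f g : (∀ i, V i) → ℝ) {M : ℝ}
    (hM : 0 ≤ M) (hf : ∀ x, |f x| ≤ M) : l2norm μ (f * g) ≤ M * l2norm μ g := by
  rw [l2norm, l2norm, ← Real.sqrt_sq hM, ← Real.sqrt_mul (sq_nonneg M)]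
  refine Real.sqrt_le_sqrt ?_
  rw [normSq, normSq, Finset.mul_sum]
  refine Finset.sum_le_sum fun x _ => ?_
  have h1 : f x ^ 2 ≤ M ^ 2 := by
    rw [← sq_abs]; exact pow_le_pow_left₀ (abs_nonneg _) (hf x) 2
  have h2 := mul_le_mul_of_nonneg_right h1 (mul_nonneg (hμ.1 x) (sq_nonneg (g x)))
  simp only [Pi.mul_apply]
  linarith

/-! ### Averaging operators -/

lemma marg_congr (μ : (∀ i, V i) → ℝ) {S : Finset (Fin k)} {x y : ∀ i, V i}
    (h : ∀ i ∈ S, x i = y i) : marg μ S x = marg μ S y := by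
  refine Finset.sum_congr rfl fun z _ => if_congr ?_ rfl rfl
  exact ⟨fun hz i hi => (hz i hi).trans (h i hi), fun hz i hi => (hz i hi).trans (h i hi).symm⟩

lemma marg_nonneg {μ : (∀ i, V i) → ℝ} (hμ : IsProb μ) (S : Finset (Fin k)) (x : ∀ i, V i) :
    0 ≤ marg μ S x :=
  Finset.sum_nonneg fun z _ => by split_ifs <;> simp [hμ.1 z]

lemma le_marg {μ : (∀ i, V i) → ℝ} (hμ : IsProb μ) (S : Finset (Fin k)) (x : ∀ i, V i) :
    μ x ≤ marg μ S x := by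
  have := Finset.single_le_sum (f := fun z => if ∀ i ∈ S, z i = x i then μ z else 0)
    (fun z _ => by split_ifs <;> simp [hμ.1 z]) (Finset.mem_univ x)
  simpa [marg] using this

lemma marg_pos {μ : (∀ i, V i) → ℝ} (hμ : IsProb μ) (S : Finset (Fin k)) {x : ∀ i, V i}
    (hx : μ x ≠ 0) : 0 < marg μ S x :=
  lt_of_lt_of_le (lt_of_le_of_ne (hμ.1 x) hx.symm) (le_marg hμ S x)

lemma cond_nonneg {μ : (∀ i, V i) → ℝ} (hμ : IsProb μ) (S : Finset (Fin k)) (x z : ∀ i, V i) :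
    0 ≤ cond μ S x z := by
  rw [cond]; split_ifs
  · exact div_nonneg (hμ.1 z) (marg_nonneg hμ S x)
  · exact le_rfl

lemma sum_cond (μ : (∀ i, V i) → ℝ) (S : Finset (Fin k)) (x : ∀ i, V i) :
    ∑ z, cond μ S x z = marg μ S x / marg μ S x := by
  rw [show marg μ S x / marg μ S x =
    (∑ z, if ∀ i ∈ S, z i = x i then μ z else 0) / marg μ S x from rfl, Finset.sum_div]
  refine Finset.sum_congr rfl fun z _ => ?_
  rw [cond]; split_ifs <;> simp

lemma sum_cond_le_one (μ : (∀ i, V i) → ℝ) (S : Finset (Fin k)) (x : ∀ i, V i) :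
    ∑ z, cond μ S x z ≤ 1 := by
  rw [sum_cond]; exact div_self_le_one _

/-- The averaging operator as a linear map. -/
noncomputable def avg (μ : (∀ i, V i) → ℝ) (S : Finset (Fin k)) :
    ((∀ i, V i) → ℝ) →ₗ[ℝ] ((∀ i, V i) → ℝ) where
  toFun := Aop μ S
  map_add' f g := by
    ext x; simp [Aop, mul_add, Finset.sum_add_distrib]
  map_smul' c f := by
    ext x
    simp only [Aop, Pi.smul_apply, smul_eq_mul, Finset.mul_sum, RingHom.id_apply]
    exact Finset.sum_congr rfl fun z _ => by ring

lemma avg_apply (μ : (∀ i, V i) → ℝ) (S : Finset (Fin k)) (f : (∀ i, V i) → ℝ)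
    (x : ∀ i, V i) : avg μ S f x = ∑ z, cond μ S x z * f z := rfl

lemma Junta.mono {S T : Finset (Fin k)} (h : S ⊆ T) {f : (∀ i, V i) → ℝ} (hf : Junta S f) :
    Junta T f := fun x y hxy => hf x y fun i hi => hxy i (h hi)

lemma Junta.mul {S : Finset (Fin k)} {f g : (∀ i, V i) → ℝ} (hf : Junta S f)
    (hg : Junta S g) : Junta S (f * g) := fun x y hxy => by
  simp [hf x y hxy, hg x y hxy]

lemma junta_avg (μ : (∀ i, V i) → ℝ) (S : Finset (Fin k)) (f : (∀ i, V i) → ℝ) :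
    Junta S (avg μ S f) := by
  intro x y hxy
  rw [avg_apply, avg_apply]
  refine Finset.sum_congr rfl fun z _ => ?_
  rw [cond, cond, marg_congr μ hxy]
  congr 1
  refine if_congr ?_ rfl rfl
  exact ⟨fun hz i hi => (hz i hi).trans (hxy i hi), fun hz i hi => (hz i hi).trans (hxy i hi).symm⟩

lemma avg_mul_of_junta (μ : (∀ i, V i) → ℝ) {S : Finset (Fin k)} {g : (∀ i, V i) → ℝ}
    (hg : Junta S g) (f : (∀ i, V i) → ℝ) : avg μ S (g * f) = g * avg μ S f := by
  ext x
  simp only [avg_apply, Pi.mul_apply, Finset.mul_sum]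
  refine Finset.sum_congr rfl fun z _ => ?_
  rw [cond]; split_ifs with h
  · rw [hg z x h]; ring
  · ring

lemma avg_of_junta {μ : (∀ i, V i) → ℝ} (hμ : IsProb μ) {S : Finset (Fin k)}
    {g : (∀ i, V i) → ℝ} (hg : Junta S g) {x : ∀ i, V i} (hx : μ x ≠ 0) :
    avg μ S g x = g x := by
  have h := avg_mul_of_junta μ hg 1
  rw [mul_one] at h
  rw [h, Pi.mul_apply, avg_apply]
  simp only [Pi.one_apply, mul_one, sum_cond]
  rw [div_self (marg_pos hμ S hx).ne', mul_one]

lemma avg_avg {μ : (∀ i, V i) → ℝ} (hμ : IsProb μ) {S T : Finset (Fin k)} (h : S ⊆ T)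
    (f : (∀ i, V i) → ℝ) : avg μ S (avg μ T f) = avg μ S f := by
  ext x
  simp only [avg_apply, Finset.mul_sum]
  rw [Finset.sum_comm]
  refine Finset.sum_congr rfl fun w _ => ?_
  simp only [← mul_assoc, ← Finset.sum_mul]
  congr 1
  have key : ∀ z, cond μ S x z * cond μ T z w =
      (if ∀ i ∈ T, z i = w i then μ z else 0) * (cond μ S x w / marg μ T w) := by
    intro z
    by_cases hz : ∀ i ∈ T, w i = z i
    · have hz' : ∀ i ∈ T, z i = w i := fun i hi => (hz i hi).symm
      have e : (∀ i ∈ S, z i = x i) ↔ ∀ i ∈ S, w i = x i :=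
        ⟨fun a i hi => (hz i (h hi)).trans (a i hi), fun a i hi => (hz' i (h hi)).trans (a i hi)⟩
      rw [if_pos hz', cond, cond, cond, if_pos hz, marg_congr μ hz', if_congr e rfl rfl]
      split_ifs <;> ring
    · have hz' : ¬ ∀ i ∈ T, z i = w i := fun a => hz fun i hi => (a i hi).symm
      rw [if_neg hz', cond, cond, if_neg hz]; ring
  simp only [key, ← Finset.sum_mul]
  change marg μ T w * (cond μ S x w / marg μ T w) = _
  by_cases hw : marg μ T w = 0
  · have : μ w = 0 := le_antisymm (hw ▸ le_marg hμ T w) (hμ.1 w)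
    simp [hw, cond, this]
  · field_simp

lemma inner'_avg (μ : (∀ i, V i) → ℝ) (S : Finset (Fin k)) (f g : (∀ i, V i) → ℝ) :
    inner' μ (avg μ S f) g = inner' μ f (avg μ S g) := by
  simp only [inner', avg_apply, Finset.sum_mul, Finset.mul_sum]
  rw [Finset.sum_comm]
  refine Finset.sum_congr rfl fun z _ => Finset.sum_congr rfl fun x _ => ?_
  by_cases hz : ∀ i ∈ S, z i = x i
  · have hz' : ∀ i ∈ S, x i = z i := fun i hi => (hz i hi).symm
    rw [cond, cond, if_pos hz, if_pos hz', marg_congr μ hz]; ring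
  · have hz' : ¬ ∀ i ∈ S, x i = z i := fun a => hz fun i hi => (a i hi).symm
    rw [cond, cond, if_neg hz, if_neg hz']; ring

lemma inner'_avg_avg {μ : (∀ i, V i) → ℝ} (hμ : IsProb μ) (S : Finset (Fin k))
    (f g : (∀ i, V i) → ℝ) :
    inner' μ (avg μ S f) (avg μ S g) = inner' μ f (avg μ S g) := by
  rw [inner'_avg, avg_avg hμ subset_rfl]

lemma inner'_avg_one {μ : (∀ i, V i) → ℝ} (hμ : IsProb μ) (S : Finset (Fin k))
    (f : (∀ i, V i) → ℝ) : inner' μ (avg μ S f) 1 = inner' μ f 1 := by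
  rw [inner'_avg]
  exact inner'_congr_right f fun x hx => avg_of_junta hμ (fun _ _ _ => rfl) hx

lemma avg_mono {μ : (∀ i, V i) → ℝ} (hμ : IsProb μ) (S : Finset (Fin k))
    {f g : (∀ i, V i) → ℝ} (h : ∀ x, f x ≤ g x) (x : ∀ i, V i) :
    avg μ S f x ≤ avg μ S g x :=
  Finset.sum_le_sum fun z _ => mul_le_mul_of_nonneg_left (h z) (cond_nonneg hμ S x z)

lemma avg_nonneg {μ : (∀ i, V i) → ℝ} (hμ : IsProb μ) (S : Finset (Fin k))
    {f : (∀ i, V i) → ℝ} (h : ∀ x, 0 ≤ f x) (x : ∀ i, V i) : 0 ≤ avg μ S f x :=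
  Finset.sum_nonneg fun z _ => mul_nonneg (cond_nonneg hμ S x z) (h z)

lemma abs_avg_le {μ : (∀ i, V i) → ℝ} (hμ : IsProb μ) (S : Finset (Fin k))
    {f : (∀ i, V i) → ℝ} {M : ℝ} (hM : 0 ≤ M) (h : ∀ x, |f x| ≤ M) (x : ∀ i, V i) :
    |avg μ S f x| ≤ M := by
  rw [avg_apply]
  calc |∑ z, cond μ S x z * f z| ≤ ∑ z, |cond μ S x z * f z| := Finset.abs_sum_le_sum_abs _ _
    _ ≤ ∑ z, cond μ S x z * M := Finset.sum_le_sum fun z _ => by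
        rw [abs_mul, abs_of_nonneg (cond_nonneg hμ S x z)]
        exact mul_le_mul_of_nonneg_left (h z) (cond_nonneg hμ S x z)
    _ = (∑ z, cond μ S x z) * M := by rw [Finset.sum_mul]
    _ ≤ 1 * M := mul_le_mul_of_nonneg_right (sum_cond_le_one μ S x) hM
    _ = M := one_mul M

/-- Conditional Cauchy–Schwarz for a sum of products. -/
lemma avg_sum_mul_sq_le {μ : (∀ i, V i) → ℝ} (hμ : IsProb μ) (S : Finset (Fin k))
    {ι : Type*} (s : Finset ι) (u v : ι → (∀ i, V i) → ℝ) (x : ∀ i, V i) :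
    (avg μ S (∑ j ∈ s, u j * v j) x) ^ 2 ≤
      avg μ S (∑ j ∈ s, u j ^ 2) x * avg μ S (∑ j ∈ s, v j ^ 2) x := by
  have e : ∀ w : ι → (∀ i, V i) → ℝ, avg μ S (∑ j ∈ s, w j) x =
      ∑ p ∈ (Finset.univ : Finset (∀ i, V i)) ×ˢ s, cond μ S x p.1 * w p.2 p.1 := by
    intro w
    rw [avg_apply, Finset.sum_product]
    simp [Finset.sum_apply, Finset.mul_sum]
  rw [e, e, e]
  refine Finset.sum_sq_le_sum_mul_sum_of_sq_le_mul _ ?_ ?_ ?_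
  · intro p _; exact mul_nonneg (cond_nonneg hμ S x p.1) (sq_nonneg _)
  · intro p _; exact mul_nonneg (cond_nonneg hμ S x p.1) (sq_nonneg _)
  · intro p _; simp only [Pi.mul_apply, Pi.pow_apply]; exact le_of_eq (by ring)

lemma avg_sq_le {μ : (∀ i, V i) → ℝ} (hμ : IsProb μ) (S : Finset (Fin k))
    (f : (∀ i, V i) → ℝ) (x : ∀ i, V i) : (avg μ S f x) ^ 2 ≤ avg μ S (f ^ 2) x := by
  have h := avg_sum_mul_sq_le hμ S ({()} : Finset Unit) (fun _ => f) (fun _ => 1) x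
  simp only [Finset.sum_singleton, mul_one, one_pow] at h
  have h1 : avg μ S 1 x ≤ 1 := by
    simpa [avg_apply] using sum_cond_le_one μ S x
  have h0 : 0 ≤ avg μ S (f ^ 2) x := avg_nonneg hμ S (fun x => sq_nonneg (f x)) x
  nlinarith

lemma l2norm_avg_le {μ : (∀ i, V i) → ℝ} (hμ : IsProb μ) (S : Finset (Fin k))
    (f : (∀ i, V i) → ℝ) : l2norm μ (avg μ S f) ≤ l2norm μ f := by
  have h : l2norm μ (avg μ S f) ^ 2 ≤ l2norm μ f * l2norm μ (avg μ S f) := by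
    rw [l2norm_sq hμ, inner'_avg_avg hμ]
    exact (le_abs_self _).trans (abs_inner'_le hμ _ _)
  rcases (l2norm_nonneg μ (avg μ S f)).eq_or_lt with h0 | h0
  · rw [← h0]; exact l2norm_nonneg μ f
  · rw [sq] at h; exact le_of_mul_le_mul_right h h0

/-! ### Averaging operators of `ε`-product measures almost commute -/

lemma expect_cond_eq_avg (μ : (∀ i, V i) → ℝ) (S : Finset (Fin k)) (x : ∀ i, V i)
    {F G : (∀ i, V i) → ℝ} (h : ∀ z, (∀ i ∈ S, z i = x i) → F z = G z) :
    expect (cond μ S x) F = avg μ S G x := by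
  rw [expect, avg_apply]
  refine Finset.sum_congr rfl fun z _ => ?_
  by_cases hz : ∀ i ∈ S, z i = x i
  · rw [h z hz]
  · rw [cond, if_neg hz]; ring

lemma Junta.update_eq {S : Finset (Fin k)} {i : Fin k} {g : (∀ i, V i) → ℝ}
    (hg : Junta (insert i S) g) {x z : ∀ i, V i} (hz : ∀ i ∈ S, z i = x i) :
    g (Function.update x i (z i)) = g z := by
  refine hg _ _ fun j hj => ?_
  by_cases hji : j = i
  · subst hji; simp
  · rw [Function.update_of_ne hji, hz j ((Finset.mem_insert.1 hj).resolve_left hji)]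

lemma abs_avg_mul_sub_le {μ : (∀ i, V i) → ℝ} {ε : ℝ} (hμ : IsProb μ) (hε : 0 ≤ ε)
    (hE : EpsProduct μ ε) {S : Finset (Fin k)} {i j : Fin k} (hi : i ∉ S) (hj : j ∉ S)
    (hij : i ≠ j) {g h : (∀ i, V i) → ℝ} (hg : Junta (insert i S) g)
    (hh : Junta (insert j S) h) {x : ∀ i, V i} (hx : 0 < marg μ S x) :
    |avg μ S (g * h) x - avg μ S g x * avg μ S h x| ≤
      ε * (Real.sqrt (avg μ S (g ^ 2) x) * Real.sqrt (avg μ S (h ^ 2) x)) := by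
  have hcard : S.card ≤ k - 2 := by
    have h1 : (insert i (insert j S)).card = S.card + 2 := by
      rw [Finset.card_insert_of_notMem (by simp [hij, hi]), Finset.card_insert_of_notMem hj]
    have h2 := Finset.card_le_univ (insert i (insert j S))
    rw [Fintype.card_fin] at h2
    omega
  have key := hE S hcard x hx i j hi hj hij (fun v => g (Function.update x i v))
    (fun v => h (Function.update x j v))
  rw [expect_cond_eq_avg μ S x (G := g * h)
      (fun z hz => by rw [hg.update_eq hz, hh.update_eq hz, Pi.mul_apply]),
    expect_cond_eq_avg μ S x (G := g) (fun z hz => by rw [hg.update_eq hz]),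
    expect_cond_eq_avg μ S x (G := h) (fun z hz => by rw [hh.update_eq hz]),
    expect_cond_eq_avg μ S x (G := g ^ 2) (fun z hz => by rw [hg.update_eq hz, Pi.pow_apply]),
    expect_cond_eq_avg μ S x (G := h ^ 2) (fun z hz => by rw [hh.update_eq hz, Pi.pow_apply])]
    at key
  refine key.trans (mul_le_mul_of_nonneg_left ?_ hε)
  have a1 := avg_sq_le hμ S g x
  have a2 := avg_sq_le hμ S h x
  have a3 := sq_nonneg (avg μ S g x)
  have a4 := sq_nonneg (avg μ S h x)
  rw [← Real.sqrt_mul (a3.trans a1)]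
  exact Real.sqrt_le_sqrt (mul_le_mul (by linarith) (by linarith) (by linarith) (by linarith))

lemma l2norm_sqrt_avg_sq {μ : (∀ i, V i) → ℝ} (hμ : IsProb μ) (S : Finset (Fin k))
    (g : (∀ i, V i) → ℝ) :
    l2norm μ (fun x => Real.sqrt (avg μ S (g ^ 2) x)) = l2norm μ g := by
  have h := inner'_avg_one hμ S (g ^ 2)
  simp only [inner', Pi.one_apply, mul_one] at h
  rw [l2norm, l2norm, normSq, normSq]
  congr 1
  rw [show ∑ x, μ x * g x ^ 2 = ∑ x, μ x * (g ^ 2) x from rfl, ← h]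
  refine Finset.sum_congr rfl fun x _ => ?_
  have hx : 0 ≤ avg μ S (g ^ 2) x := avg_nonneg hμ S (fun x => sq_nonneg (g x)) x
  rw [Real.sq_sqrt hx]

lemma abs_inner'_sub_avg_le {μ : (∀ i, V i) → ℝ} {ε : ℝ} (hμ : IsProb μ) (hε : 0 ≤ ε)
    (hE : EpsProduct μ ε) {S : Finset (Fin k)} {i j : Fin k} (hi : i ∉ S) (hj : j ∉ S)
    (hij : i ≠ j) {g h : (∀ i, V i) → ℝ} (hg : Junta (insert i S) g)
    (hh : Junta (insert j S) h) :
    |inner' μ g h - inner' μ (avg μ S g) (avg μ S h)| ≤ ε * (l2norm μ g * l2norm μ h) := by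
  have e1 : inner' μ g h = ∑ x, μ x * avg μ S (g * h) x := by
    have := inner'_avg_one hμ S (g * h)
    simp only [inner', Pi.one_apply, mul_one] at this
    rw [this]; rfl
  rw [e1, inner', ← Finset.sum_sub_distrib]
  calc |∑ x, (μ x * avg μ S (g * h) x - μ x * (avg μ S g x * avg μ S h x))|
      ≤ ∑ x, |μ x * avg μ S (g * h) x - μ x * (avg μ S g x * avg μ S h x)| :=
        Finset.abs_sum_le_sum_abs _ _
    _ ≤ ∑ x, ε * (μ x * (Real.sqrt (avg μ S (g ^ 2) x) * Real.sqrt (avg μ S (h ^ 2) x))) := by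
        refine Finset.sum_le_sum fun x _ => ?_
        by_cases hx : μ x = 0
        · simp [hx]
        · rw [← mul_sub, abs_mul, abs_of_nonneg (hμ.1 x)]
          have := mul_le_mul_of_nonneg_left
            (abs_avg_mul_sub_le hμ hε hE hi hj hij hg hh (marg_pos hμ S hx)) (hμ.1 x)
          linarith
    _ = ε * inner' μ (fun x => Real.sqrt (avg μ S (g ^ 2) x))
          (fun x => Real.sqrt (avg μ S (h ^ 2) x)) := by
        rw [← Finset.mul_sum]; rfl
    _ ≤ ε * (l2norm μ g * l2norm μ h) := by
        refine mul_le_mul_of_nonneg_left ?_ hε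
        have := abs_inner'_le hμ (fun x => Real.sqrt (avg μ S (g ^ 2) x))
          (fun x => Real.sqrt (avg μ S (h ^ 2) x))
        rw [l2norm_sqrt_avg_sq hμ, l2norm_sqrt_avg_sq hμ] at this
        exact (le_abs_self _).trans this

lemma le_of_sq_le_mul {a b : ℝ} (ha : 0 ≤ a) (hb : 0 ≤ b) (h : a ^ 2 ≤ b * a) : a ≤ b := by
  rcases ha.eq_or_lt with h0 | h0
  · rw [← h0]; exact hb
  · rw [sq] at h; exact le_of_mul_le_mul_right h h0

lemma l2norm_avg_insert_avg_insert_sub_le {μ : (∀ i, V i) → ℝ} {ε : ℝ} (hμ : IsProb μ)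
    (hε : 0 ≤ ε) (hE : EpsProduct μ ε) {S : Finset (Fin k)} {i j : Fin k} (hi : i ∉ S)
    (hj : j ∉ S) (hij : i ≠ j) (F : (∀ i, V i) → ℝ) :
    l2norm μ (avg μ (insert i S) (avg μ (insert j S) F) - avg μ S F) ≤ ε * l2norm μ F := by
  set h := avg μ (insert j S) F with hh
  set g := avg μ (insert i S) (h - avg μ S F) with hg
  have e0 : l2norm μ (avg μ (insert i S) h - avg μ S F) = l2norm μ g := by
    refine l2norm_congr fun x hx => ?_
    rw [hg, map_sub, Pi.sub_apply, Pi.sub_apply,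
      avg_of_junta hμ ((junta_avg μ S F).mono (Finset.subset_insert i S)) hx]
  rw [e0]
  refine le_of_sq_le_mul (l2norm_nonneg _ _) (mul_nonneg hε (l2norm_nonneg _ _)) ?_
  have e1 : inner' μ g g = inner' μ g h - inner' μ (avg μ S g) (avg μ S h) := by
    have e2 : avg μ S h = avg μ S F := avg_avg hμ (Finset.subset_insert j S) F
    have e3 : inner' μ (avg μ S g) (avg μ S h) = inner' μ g (avg μ S F) := by
      rw [inner'_avg_avg hμ S g h, e2]
    rw [e3, ← inner'_sub_right, hg, inner'_avg_avg hμ, ← inner'_avg]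
  rw [l2norm_sq hμ, e1]
  refine (le_abs_self _).trans ((abs_inner'_sub_avg_le hμ hε hE hi hj hij
    (junta_avg μ _ _) (junta_avg μ _ _)).trans ?_)
  have h1 : l2norm μ h ≤ l2norm μ F := l2norm_avg_le hμ _ _
  have h2 := mul_le_mul_of_nonneg_left h1 (mul_nonneg hε (l2norm_nonneg μ g))
  linarith

lemma l2norm_triangle {μ : (∀ i, V i) → ℝ} (hμ : IsProb μ) (f g h : (∀ i, V i) → ℝ) :
    l2norm μ (f - h) ≤ l2norm μ (f - g) + l2norm μ (g - h) := by
  have := l2norm_add_le hμ (f - g) (g - h)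
  rwa [sub_add_sub_cancel] at this

lemma l2norm_avg_avg_erase_sub_le {μ : (∀ i, V i) → ℝ} {ε : ℝ} (hμ : IsProb μ)
    (hε : 0 ≤ ε) (hE : EpsProduct μ ε) (i : Fin k) (F : (∀ i, V i) → ℝ) (U : Finset (Fin k))
    (hU : i ∉ U) :
    l2norm μ (avg μ Uᶜ (avg μ (univ.erase i) F) - avg μ (Uᶜ.erase i) F) ≤
      U.card * ε * l2norm μ F := by
  induction U using Finset.induction_on with
  | empty =>
    refine le_of_eq ?_
    simp only [Finset.compl_empty, Finset.card_empty, Nat.cast_zero, zero_mul]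
    rw [← l2norm_zero μ]
    refine l2norm_congr fun x hx => ?_
    rw [Pi.sub_apply, avg_of_junta hμ ((junta_avg μ _ _).mono (Finset.subset_univ _)) hx, sub_self]
    rfl
  | insert j U hj ih =>
    have hij : i ≠ j := fun h => hU (h ▸ Finset.mem_insert_self _ _)
    have hiU : i ∉ U := fun h => hU (Finset.mem_insert_of_mem h)
    have ih := ih hiU
    set Q := (insert i (insert j U))ᶜ with hQ
    have e1 : (insert j U)ᶜ = insert i Q := by
      ext a; simp only [hQ, Finset.mem_compl, Finset.mem_insert]; grind
    have e2 : Uᶜ.erase i = insert j Q := by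
      ext a; simp only [hQ, Finset.mem_compl, Finset.mem_insert, Finset.mem_erase]; grind
    have e3 : (insert j U)ᶜ.erase i = Q := by
      ext a; simp only [hQ, Finset.mem_compl, Finset.mem_insert, Finset.mem_erase]; grind
    have hsub : insert i Q ⊆ Uᶜ := by
      intro a; simp only [hQ, Finset.mem_compl, Finset.mem_insert]; grind
    rw [e3, e1, ← avg_avg hμ hsub]
    rw [e2] at ih
    refine (l2norm_triangle hμ _ (avg μ (insert i Q) (avg μ (insert j Q) F)) _).trans ?_
    have h1 := l2norm_avg_insert_avg_insert_sub_le hμ hε hE (S := Q) (i := i) (j := j)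
      (by simp [hQ]) (by simp [hQ]) hij F
    have h2 := l2norm_avg_le hμ (insert i Q)
      (avg μ Uᶜ (avg μ (univ.erase i) F) - avg μ (insert j Q) F)
    rw [map_sub] at h2
    rw [Finset.card_insert_of_notMem hj]
    push_cast
    linarith

lemma l2norm_avg_avg_sub_le_card {μ : (∀ i, V i) → ℝ} {ε : ℝ} (hμ : IsProb μ)
    (hε : 0 ≤ ε) (hE : EpsProduct μ ε) (S U : Finset (Fin k)) (F : (∀ i, V i) → ℝ) :
    l2norm μ (avg μ S (avg μ Uᶜ F) - avg μ (S ∩ Uᶜ) F) ≤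
      U.card * (2 * k * ε) * l2norm μ F := by
  have hk : ∀ W : Finset (Fin k), (W.card : ℝ) ≤ k := fun W => by
    have := Finset.card_le_univ W
    rw [Fintype.card_fin] at this
    exact_mod_cast this
  have step : ∀ (i : Fin k) (W : Finset (Fin k)) (G : (∀ i, V i) → ℝ), i ∈ W →
      l2norm μ (avg μ W (avg μ (univ.erase i) G) - avg μ (W.erase i) G) ≤
        k * ε * l2norm μ G := by
    intro i W G hi
    have h := l2norm_avg_avg_erase_sub_le hμ hε hE i G Wᶜ (by simpa using hi)
    rw [compl_compl] at h
    exact h.trans (by have := l2norm_nonneg μ G; have := hk Wᶜ; gcongr)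
  induction U using Finset.induction_on generalizing F with
  | empty =>
    refine le_of_eq ?_
    simp only [Finset.compl_empty, Finset.inter_univ, Finset.card_empty, Nat.cast_zero, zero_mul,
      avg_avg hμ (Finset.subset_univ S), sub_self]
    exact l2norm_zero μ
  | insert t U ht ih =>
    have e1 : (insert t U)ᶜ = Uᶜ.erase t := by
      ext a; simp only [Finset.mem_compl, Finset.mem_insert, Finset.mem_erase]; grind
    have e2 : S ∩ (insert t U)ᶜ = (S ∩ Uᶜ).erase t := by
      ext a; simp only [Finset.mem_compl, Finset.mem_insert, Finset.mem_erase, Finset.mem_inter]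
      grind
    have hF := l2norm_nonneg μ F
    have h1 : l2norm μ (avg μ S (avg μ (insert t U)ᶜ F) -
        avg μ S (avg μ Uᶜ (avg μ (univ.erase t) F))) ≤ k * ε * l2norm μ F := by
      rw [← map_sub]
      refine (l2norm_avg_le hμ _ _).trans ?_
      have h := step t Uᶜ F (by simpa using ht)
      have hs := l2norm_smul hμ (-1) (avg μ Uᶜ (avg μ (univ.erase t) F) - avg μ (Uᶜ.erase t) F)
      rw [neg_one_smul, neg_sub, abs_neg, abs_one, one_mul] at hs
      rw [e1, hs]; exact h
    have h2 := ih (avg μ (univ.erase t) F)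
    have h2' : l2norm μ (avg μ S (avg μ Uᶜ (avg μ (univ.erase t) F)) -
        avg μ (S ∩ Uᶜ) (avg μ (univ.erase t) F)) ≤ U.card * (2 * k * ε) * l2norm μ F :=
      h2.trans (by have := l2norm_avg_le hμ (univ.erase t) F; gcongr)
    have h3 : l2norm μ (avg μ (S ∩ Uᶜ) (avg μ (univ.erase t) F) -
        avg μ ((S ∩ Uᶜ).erase t) F) ≤ k * ε * l2norm μ F := by
      by_cases htS : t ∈ S ∩ Uᶜ
      · exact step t _ F htS
      · rw [Finset.erase_eq_of_notMem htS, avg_avg hμ, sub_self, l2norm_zero]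
        · positivity
        · intro a ha
          exact Finset.mem_erase.2 ⟨fun h => htS (h ▸ ha), Finset.mem_univ a⟩
    rw [e2, Finset.card_insert_of_notMem ht]
    push_cast
    have t1 := l2norm_triangle hμ (avg μ S (avg μ (insert t U)ᶜ F))
      (avg μ S (avg μ Uᶜ (avg μ (univ.erase t) F))) (avg μ ((S ∩ Uᶜ).erase t) F)
    have t2 := l2norm_triangle hμ (avg μ S (avg μ Uᶜ (avg μ (univ.erase t) F)))
      (avg μ (S ∩ Uᶜ) (avg μ (univ.erase t) F)) (avg μ ((S ∩ Uᶜ).erase t) F)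
    linarith

/-- The averaging operators of `μ` commute up to an `L²`-operator error `η`. -/
def AlmostCommute (μ : (∀ i, V i) → ℝ) (η : ℝ) : Prop :=
  ∀ (S T : Finset (Fin k)) (F : (∀ i, V i) → ℝ),
    l2norm μ (avg μ S (avg μ T F) - avg μ (S ∩ T) F) ≤ η * l2norm μ F

lemma EpsProduct.almostCommute {μ : (∀ i, V i) → ℝ} {ε : ℝ} (hμ : IsProb μ)
    (hε : 0 ≤ ε) (hE : EpsProduct μ ε) : AlmostCommute μ (2 * k ^ 2 * ε) := by
  intro S T F
  have h := l2norm_avg_avg_sub_le_card hμ hε hE S Tᶜ F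
  rw [compl_compl] at h
  refine h.trans (mul_le_mul_of_nonneg_right ?_ (l2norm_nonneg _ _))
  have h1 : (Tᶜ.card : ℝ) ≤ k := by
    have := Finset.card_le_univ Tᶜ
    rw [Fintype.card_fin] at this
    exact_mod_cast this
  calc (Tᶜ.card : ℝ) * (2 * k * ε) ≤ k * (2 * k * ε) := by gcongr
    _ = 2 * k ^ 2 * ε := by ring

/-! ### Approximate Efron–Stein decomposition -/

/-- Möbius transform over the lattice of subsets. -/
noncomputable def alt {E : Type*} [AddCommGroup E] [Module ℝ E] (φ : Finset (Fin k) → E)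
    (S : Finset (Fin k)) : E :=
  ∑ T ∈ S.powerset, (-1 : ℝ) ^ (S.card - T.card) • φ T

lemma alt_insert {E : Type*} [AddCommGroup E] [Module ℝ E] (φ : Finset (Fin k) → E)
    {S : Finset (Fin k)} {a : Fin k} (ha : a ∉ S) :
    alt φ (insert a S) = alt (fun T => φ (insert a T)) S - alt φ S := by
  rw [alt, Finset.sum_powerset_insert ha, add_comm, alt, alt, sub_eq_add_neg,
    ← Finset.sum_neg_distrib]
  congr 1
  · refine Finset.sum_congr rfl fun T hT => ?_
    have hT' := Finset.mem_powerset.1 hT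
    rw [Finset.card_insert_of_notMem ha, Finset.card_insert_of_notMem fun h => ha (hT' h),
      Nat.add_sub_add_right]
  · refine Finset.sum_congr rfl fun T hT => ?_
    have hT' := Finset.card_le_card (Finset.mem_powerset.1 hT)
    rw [Finset.card_insert_of_notMem ha, Nat.sub_add_comm hT', pow_succ, mul_neg_one, neg_smul]

lemma alt_eq_zero {E : Type*} [AddCommGroup E] [Module ℝ E] (φ : Finset (Fin k) → E)
    {S : Finset (Fin k)} {a : Fin k} (ha : a ∈ S)
    (h : ∀ T, φ (insert a T) = φ T) : alt φ S = 0 := by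
  rw [← Finset.insert_erase ha, alt_insert φ (Finset.notMem_erase a S)]
  simp only [h, sub_self]

lemma sum_alt {E : Type*} [AddCommGroup E] [Module ℝ E] (φ : Finset (Fin k) → E)
    (R : Finset (Fin k)) : ∑ S ∈ R.powerset, alt φ S = φ R := by
  induction R using Finset.induction_on generalizing φ with
  | empty => simp [alt]
  | insert a R ha ih =>
    rw [Finset.sum_powerset_insert ha, ← Finset.sum_add_distrib]
    rw [← ih fun T => φ (insert a T)]
    refine Finset.sum_congr rfl fun T hT => ?_
    rw [alt_insert φ fun h => ha (Finset.mem_powerset.1 hT h), add_sub_cancel]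

lemma l2norm_alt_le {μ : (∀ i, V i) → ℝ} (hμ : IsProb μ)
    (φ : Finset (Fin k) → (∀ i, V i) → ℝ) (S : Finset (Fin k)) {c : ℝ}
    (h : ∀ T ⊆ S, l2norm μ (φ T) ≤ c) : l2norm μ (alt φ S) ≤ 2 ^ S.card * c := by
  have := l2norm_sum_le_card hμ S.powerset
    (fun T => (-1 : ℝ) ^ (S.card - T.card) • φ T) (c := c) fun T hT => by
      rw [l2norm_smul hμ, abs_pow, abs_neg, abs_one, one_pow, one_mul]
      exact h T (Finset.mem_powerset.1 hT)
  simpa [alt] using this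

lemma two_pow_card_le (S : Finset (Fin k)) : (2 : ℝ) ^ S.card ≤ 2 ^ k := by
  refine pow_le_pow_right₀ one_le_two ?_
  simpa using Finset.card_le_univ S

lemma ES_eq_alt (μ : (∀ i, V i) → ℝ) (S : Finset (Fin k)) (F : (∀ i, V i) → ℝ) :
    ES μ S F = alt (fun T => avg μ T F) S := by
  ext x
  simp only [ES, alt, Finset.sum_apply, Pi.smul_apply, smul_eq_mul]
  rfl

lemma ES_sum (μ : (∀ i, V i) → ℝ) (S : Finset (Fin k)) {ι : Type*} (s : Finset ι)
    (F : ι → (∀ i, V i) → ℝ) : ES μ S (∑ j ∈ s, F j) = ∑ j ∈ s, ES μ S (F j) := by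
  simp only [ES_eq_alt, alt, map_sum, Finset.smul_sum]
  exact Finset.sum_comm

lemma junta_ES (μ : (∀ i, V i) → ℝ) (S : Finset (Fin k)) (F : (∀ i, V i) → ℝ) :
    Junta S (ES μ S F) := by
  intro x y hxy
  refine Finset.sum_congr rfl fun T hT => ?_
  exact congrArg _ ((junta_avg μ T F).mono (Finset.mem_powerset.1 hT) x y hxy)

lemma abs_ES_le {μ : (∀ i, V i) → ℝ} (hμ : IsProb μ) (S : Finset (Fin k))
    {F : (∀ i, V i) → ℝ} (h : ∀ x, |F x| ≤ 1) (x : ∀ i, V i) : |ES μ S F x| ≤ 2 ^ k := by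
  refine (Finset.abs_sum_le_sum_abs _ _).trans ?_
  have : ∀ T ∈ S.powerset, |(-1 : ℝ) ^ (S.card - T.card) * Aop μ T F x| ≤ 1 := fun T _ => by
    rw [abs_mul, abs_pow, abs_neg, abs_one, one_pow, one_mul]
    exact abs_avg_le hμ T zero_le_one h x
  refine (Finset.sum_le_card_nsmul _ _ _ this).trans ?_
  simpa using two_pow_card_le S

lemma l2norm_ES_le_avg {μ : (∀ i, V i) → ℝ} (hμ : IsProb μ) (S : Finset (Fin k))
    (F : (∀ i, V i) → ℝ) : l2norm μ (ES μ S F) ≤ 2 ^ S.card * l2norm μ (avg μ S F) := by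
  rw [ES_eq_alt]
  refine l2norm_alt_le hμ _ S fun T hT => ?_
  rw [← avg_avg hμ hT]
  exact l2norm_avg_le hμ _ _

lemma l2norm_ES_le {μ : (∀ i, V i) → ℝ} (hμ : IsProb μ) (S : Finset (Fin k))
    (F : (∀ i, V i) → ℝ) : l2norm μ (ES μ S F) ≤ 2 ^ k * l2norm μ F :=
  (l2norm_ES_le_avg hμ S F).trans (mul_le_mul (two_pow_card_le S) (l2norm_avg_le hμ _ _)
    (l2norm_nonneg _ _) (by positivity))

lemma sum_ES {μ : (∀ i, V i) → ℝ} (hμ : IsProb μ) (F : (∀ i, V i) → ℝ) {x : ∀ i, V i}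
    (hx : μ x ≠ 0) : (∑ S : Finset (Fin k), ES μ S F) x = F x := by
  have h := sum_alt (fun T => avg μ T F) Finset.univ
  simp only [← ES_eq_alt, Finset.powerset_univ] at h
  rw [h]
  exact avg_of_junta hμ (fun a b hab => congrArg F (funext fun i => hab i (Finset.mem_univ i))) hx

lemma l2norm_alt_sub_le {μ : (∀ i, V i) → ℝ} {η : ℝ} (hμ : IsProb μ) (hη : 0 ≤ η)
    (φ : Finset (Fin k) → (∀ i, V i) → ℝ) (F : (∀ i, V i) → ℝ) {S : Finset (Fin k)} {i : Fin k}
    (hi : i ∈ S) (h : ∀ T, l2norm μ (φ T - avg μ (T.erase i) F) ≤ η * l2norm μ F) :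
    l2norm μ (alt φ S) ≤ 2 ^ k * (η * l2norm μ F) := by
  have h0 : alt (fun T => avg μ (T.erase i) F) S = 0 :=
    alt_eq_zero _ hi fun T => by
      congr 2; ext a; simp only [Finset.mem_erase, Finset.mem_insert]; grind
  have e : alt φ S = alt (fun T => φ T - avg μ (T.erase i) F) S := by
    rw [← sub_zero (alt φ S), ← h0]
    simp only [alt, smul_sub, Finset.sum_sub_distrib]
  rw [e]
  refine (l2norm_alt_le hμ _ S fun T _ => h T).trans ?_
  exact mul_le_mul_of_nonneg_right (two_pow_card_le S) (mul_nonneg hη (l2norm_nonneg _ _))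

lemma l2norm_avg_erase_ES_le {μ : (∀ i, V i) → ℝ} {η : ℝ} (hμ : IsProb μ) (hη : 0 ≤ η)
    (hC : AlmostCommute μ η) {S : Finset (Fin k)} {i : Fin k} (hi : i ∈ S)
    (F : (∀ i, V i) → ℝ) :
    l2norm μ (avg μ (univ.erase i) (ES μ S F)) ≤ 2 ^ k * (η * l2norm μ F) := by
  have e : avg μ (univ.erase i) (ES μ S F) =
      alt (fun T => avg μ (univ.erase i) (avg μ T F)) S := by
    rw [ES_eq_alt, alt, alt, map_sum]
    simp only [map_smul]
  rw [e]
  refine l2norm_alt_sub_le hμ hη _ F hi fun T => ?_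
  have := hC (univ.erase i) T F
  rwa [Finset.erase_inter, Finset.univ_inter] at this

lemma l2norm_ES_avg_erase_le {μ : (∀ i, V i) → ℝ} {η : ℝ} (hμ : IsProb μ) (hη : 0 ≤ η)
    (hC : AlmostCommute μ η) {S : Finset (Fin k)} {i : Fin k} (hi : i ∈ S)
    (F : (∀ i, V i) → ℝ) :
    l2norm μ (ES μ S (avg μ (univ.erase i) F)) ≤ 2 ^ k * (η * l2norm μ F) := by
  rw [ES_eq_alt]
  refine l2norm_alt_sub_le hμ hη _ F hi fun T => ?_
  have := hC T (univ.erase i) F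
  rwa [Finset.inter_erase, Finset.inter_univ] at this

lemma abs_inner'_ES_le_of_mem {μ : (∀ i, V i) → ℝ} {η : ℝ} (hμ : IsProb μ) (hη : 0 ≤ η)
    (hC : AlmostCommute μ η) {S T : Finset (Fin k)} {i : Fin k} (hi : i ∈ S) (hi' : i ∉ T)
    (F : (∀ i, V i) → ℝ) :
    |inner' μ (ES μ S F) (ES μ T F)| ≤ (2 ^ k) ^ 2 * η * l2norm μ F ^ 2 := by
  have hj : Junta (univ.erase i) (ES μ T F) := (junta_ES μ T F).mono fun a ha =>
    Finset.mem_erase.2 ⟨by rintro rfl; exact hi' ha, Finset.mem_univ a⟩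
  have e : inner' μ (ES μ S F) (ES μ T F) =
      inner' μ (avg μ (univ.erase i) (ES μ S F)) (ES μ T F) := by
    rw [inner'_avg]
    exact (inner'_congr_right _ fun x hx => avg_of_junta hμ hj hx).symm
  rw [e]
  refine (abs_inner'_le hμ _ _).trans ?_
  have h1 := l2norm_avg_erase_ES_le hμ hη hC hi F
  have h2 := l2norm_ES_le hμ T F
  have h3 := l2norm_nonneg μ F
  calc _ ≤ 2 ^ k * (η * l2norm μ F) * (2 ^ k * l2norm μ F) :=
        mul_le_mul h1 h2 (l2norm_nonneg _ _) (by positivity)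
    _ = _ := by ring

lemma exists_mem_notMem_of_ne {S T : Finset (Fin k)} (h : S ≠ T) :
    (∃ i ∈ S, i ∉ T) ∨ ∃ i ∈ T, i ∉ S := by
  by_contra! hc
  exact h (Finset.Subset.antisymm hc.1 hc.2)

lemma abs_inner'_ES_le {μ : (∀ i, V i) → ℝ} {η : ℝ} (hμ : IsProb μ) (hη : 0 ≤ η)
    (hC : AlmostCommute μ η) {S T : Finset (Fin k)} (hST : S ≠ T) (F : (∀ i, V i) → ℝ) :
    |inner' μ (ES μ S F) (ES μ T F)| ≤ (2 ^ k) ^ 2 * η * l2norm μ F ^ 2 := by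
  rcases exists_mem_notMem_of_ne hST with ⟨i, hi, hi'⟩ | ⟨i, hi, hi'⟩
  · exact abs_inner'_ES_le_of_mem hμ hη hC hi hi' F
  · rw [inner'_comm]
    exact abs_inner'_ES_le_of_mem hμ hη hC hi hi' F

lemma card_univ_finset : ((Finset.univ : Finset (Finset (Fin k))).card : ℝ) = 2 ^ k := by
  simp

lemma abs_inner'_ES_self_sub_le {μ : (∀ i, V i) → ℝ} {η : ℝ} (hμ : IsProb μ) (hη : 0 ≤ η)
    (hC : AlmostCommute μ η) (S : Finset (Fin k)) (F : (∀ i, V i) → ℝ) :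
    |inner' μ (ES μ S F) F - l2norm μ (ES μ S F) ^ 2| ≤ (2 ^ k) ^ 3 * η * l2norm μ F ^ 2 := by
  have e : inner' μ (ES μ S F) F = ∑ T : Finset (Fin k), inner' μ (ES μ S F) (ES μ T F) := by
    rw [← inner'_sum_right]
    exact (inner'_congr_right _ fun x hx => sum_ES hμ F hx).symm
  rw [e, ← Finset.add_sum_erase _ _ (Finset.mem_univ S), l2norm_sq hμ, add_sub_cancel_left]
  refine (Finset.abs_sum_le_sum_abs _ _).trans ?_
  have h3 := l2norm_nonneg μ F
  refine (Finset.sum_le_card_nsmul _ _ _ fun T hT =>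
    abs_inner'_ES_le hμ hη hC (Finset.ne_of_mem_erase hT).symm F).trans ?_
  rw [nsmul_eq_mul]
  have : ((univ.erase S).card : ℝ) ≤ 2 ^ k := by
    rw [← card_univ_finset]
    exact_mod_cast Finset.card_le_card (Finset.erase_subset _ _)
  calc _ ≤ 2 ^ k * ((2 ^ k) ^ 2 * η * l2norm μ F ^ 2) := by gcongr
    _ = _ := by ring

lemma abs_l2norm_sq_sub_sum_ES_le {μ : (∀ i, V i) → ℝ} {η : ℝ} (hμ : IsProb μ) (hη : 0 ≤ η)
    (hC : AlmostCommute μ η) (F : (∀ i, V i) → ℝ) :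
    |l2norm μ F ^ 2 - ∑ S : Finset (Fin k), l2norm μ (ES μ S F) ^ 2| ≤
      (2 ^ k) ^ 4 * η * l2norm μ F ^ 2 := by
  have e : l2norm μ F ^ 2 - ∑ S : Finset (Fin k), l2norm μ (ES μ S F) ^ 2 =
      ∑ S : Finset (Fin k), (inner' μ (ES μ S F) F - l2norm μ (ES μ S F) ^ 2) := by
    rw [Finset.sum_sub_distrib, ← inner'_sum_left,
      inner'_comm μ (∑ S : Finset (Fin k), ES μ S F) F, l2norm_sq hμ F,
      inner'_congr_right F fun x hx => sum_ES hμ F hx]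
  rw [e]
  refine (Finset.abs_sum_le_sum_abs _ _).trans ?_
  refine (Finset.sum_le_card_nsmul _ _ _ fun S _ =>
    abs_inner'_ES_self_sub_le hμ hη hC S F).trans ?_
  rw [nsmul_eq_mul, card_univ_finset]
  exact le_of_eq (by ring)

/-! ### Fourth moments of sums of approximately Efron–Stein components -/

lemma avg_congr {μ : (∀ i, V i) → ℝ} (S : Finset (Fin k)) {f g : (∀ i, V i) → ℝ}
    (h : ∀ x, μ x ≠ 0 → f x = g x) : avg μ S f = avg μ S g := by
  ext x
  rw [avg_apply, avg_apply]
  refine Finset.sum_congr rfl fun z _ => ?_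
  by_cases hz : μ z = 0
  · simp [cond, hz]
  · rw [h z hz]

lemma ES_congr {μ : (∀ i, V i) → ℝ} (S : Finset (Fin k)) {f g : (∀ i, V i) → ℝ}
    (h : ∀ x, μ x ≠ 0 → f x = g x) : ES μ S f = ES μ S g := by
  rw [ES_eq_alt, ES_eq_alt]
  congr 1
  ext1 T
  exact avg_congr T h

lemma inner'_avg_eq {μ : (∀ i, V i) → ℝ} (hμ : IsProb μ) (S : Finset (Fin k))
    (f g : (∀ i, V i) → ℝ) : inner' μ (avg μ S f) (avg μ S g) = inner' μ (avg μ S f) g := by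
  rw [inner'_avg_avg hμ, ← inner'_avg]

lemma abs_inner'_avg_sub_le {μ : (∀ i, V i) → ℝ} {η : ℝ} (hμ : IsProb μ)
    (hC : AlmostCommute μ η) {S T : Finset (Fin k)} (R : Finset (Fin k))
    {X Y : (∀ i, V i) → ℝ} (hX : Junta S X) (hY : Junta T Y) :
    |inner' μ (avg μ R X) (avg μ R Y) -
        inner' μ (avg μ ((S ∩ R) ∩ (T ∩ R)) X) (avg μ ((S ∩ R) ∩ (T ∩ R)) Y)| ≤
      2 * η * (l2norm μ X * l2norm μ Y) := by
  have hX' : avg μ R X = avg μ R (avg μ S X) :=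
    avg_congr R fun x hx => (avg_of_junta hμ hX hx).symm
  have hY' : inner' μ (avg μ (R ∩ S) X) Y = inner' μ (avg μ T (avg μ (R ∩ S) X)) Y := by
    rw [inner'_avg μ T]
    exact inner'_congr_right _ fun x hx => (avg_of_junta hμ hY hx).symm
  have hB : (S ∩ R) ∩ (T ∩ R) = T ∩ (R ∩ S) := by ext; simp; tauto
  rw [inner'_avg_eq hμ, inner'_avg_eq hμ, hB, hX']
  have e : inner' μ (avg μ R (avg μ S X)) Y - inner' μ (avg μ (T ∩ (R ∩ S)) X) Y =
      inner' μ (avg μ R (avg μ S X) - avg μ (R ∩ S) X) Y +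
        inner' μ (avg μ T (avg μ (R ∩ S) X) - avg μ (T ∩ (R ∩ S)) X) Y := by
    rw [inner'_sub_left, inner'_sub_left, hY']
    ring
  rw [e]
  have h3 := l2norm_nonneg μ Y
  have h1 := (abs_inner'_le hμ (avg μ R (avg μ S X) - avg μ (R ∩ S) X) Y).trans
    (mul_le_mul_of_nonneg_right (hC R S X) h3)
  have h2 := (abs_inner'_le hμ (avg μ T (avg μ (R ∩ S) X) - avg μ (T ∩ (R ∩ S)) X) Y).trans
    (mul_le_mul_of_nonneg_right (hC T (R ∩ S) X) h3)
  refine (abs_add_le _ _).trans ((add_le_add h1 h2).trans (le_of_eq ?_))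
  ring

/-- A family of functions behaving like the Efron–Stein components of a bounded function of
norm `N`. -/
structure ESFamily (μ : (∀ i, V i) → ℝ) (η N : ℝ) (a : Finset (Fin k) → (∀ i, V i) → ℝ) :
    Prop where
  junta : ∀ S, Junta S (a S)
  abs_apply_le : ∀ S x, |a S x| ≤ 2 ^ k
  norm_le : ∀ S, l2norm μ (a S) ≤ 2 ^ k * N
  norm_avg_erase_le : ∀ S, ∀ i ∈ S, l2norm μ (avg μ (univ.erase i) (a S)) ≤ 2 ^ k * (η * N)

namespace ESFamily

variable {μ : (∀ i, V i) → ℝ} {η N : ℝ} {a : Finset (Fin k) → (∀ i, V i) → ℝ}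

lemma norm_mul_le (ha : ESFamily μ η N a) (hμ : IsProb μ) (S T : Finset (Fin k)) :
    l2norm μ (a S * a T) ≤ (2 ^ k) ^ 2 * N :=
  (l2norm_mul_le hμ _ _ (by positivity) (ha.abs_apply_le S)).trans (by
    have := mul_le_mul_of_nonneg_left (ha.norm_le T) (by positivity : (0 : ℝ) ≤ 2 ^ k)
    linarith)

lemma norm_avg_mul_le_of_mem (ha : ESFamily μ η N a) (hμ : IsProb μ) {S T R : Finset (Fin k)}
    {i : Fin k} (hS : i ∈ S) (hT : i ∉ T) (hR : i ∉ R) :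
    l2norm μ (avg μ R (a S * a T)) ≤ (2 ^ k) ^ 2 * (η * N) := by
  have hj : Junta (univ.erase i) (a T) := (ha.junta T).mono fun j hj =>
    Finset.mem_erase.2 ⟨by rintro rfl; exact hT hj, Finset.mem_univ j⟩
  have hsub : R ⊆ univ.erase i := fun j h =>
    Finset.mem_erase.2 ⟨by rintro rfl; exact hR h, Finset.mem_univ j⟩
  rw [← avg_avg hμ hsub, mul_comm, avg_mul_of_junta μ hj]
  refine (l2norm_avg_le hμ _ _).trans
    ((l2norm_mul_le hμ _ _ (by positivity) (ha.abs_apply_le T)).trans ?_)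
  have := mul_le_mul_of_nonneg_left (ha.norm_avg_erase_le S i hS)
    (by positivity : (0 : ℝ) ≤ 2 ^ k)
  linarith

lemma norm_avg_mul_le (ha : ESFamily μ η N a) (hμ : IsProb μ) {S T R : Finset (Fin k)}
    (h : ¬ symmDiff S T ⊆ R) :
    l2norm μ (avg μ R (a S * a T)) ≤ (2 ^ k) ^ 2 * (η * N) := by
  obtain ⟨i, hi, hR⟩ := Finset.not_subset.1 h
  rcases Finset.mem_symmDiff.1 hi with ⟨h1, h2⟩ | ⟨h1, h2⟩
  · exact ha.norm_avg_mul_le_of_mem hμ h1 h2 hR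
  · rw [mul_comm]
    exact ha.norm_avg_mul_le_of_mem hμ h1 h2 hR

lemma norm_ES_mul_le (ha : ESFamily μ η N a) (hμ : IsProb μ) (hη : 0 ≤ η)
    (hC : AlmostCommute μ η) {S T R : Finset (Fin k)}
    (h : ¬ (symmDiff S T ⊆ R ∧ R ⊆ S ∪ T)) :
    l2norm μ (ES μ R (a S * a T)) ≤ (2 ^ k) ^ 3 * (η * N) := by
  by_cases h1 : symmDiff S T ⊆ R
  · obtain ⟨i, hi, hi'⟩ := Finset.not_subset.1 fun h2 => h ⟨h1, h2⟩
    rw [Finset.mem_union, not_or] at hi'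
    have hj : ∀ T', i ∉ T' → Junta (univ.erase i) (a T') := fun T' hT => (ha.junta T').mono
      fun j hj => Finset.mem_erase.2 ⟨by rintro rfl; exact hT hj, Finset.mem_univ j⟩
    have e : ES μ R (a S * a T) = ES μ R (avg μ (univ.erase i) (a S * a T)) :=
      ES_congr R fun x hx => (avg_of_junta hμ ((hj S hi'.1).mul (hj T hi'.2)) hx).symm
    rw [e]
    refine (l2norm_ES_avg_erase_le hμ hη hC hi _).trans ?_
    calc _ ≤ 2 ^ k * (η * ((2 ^ k) ^ 2 * N)) := by
          gcongr; exact ha.norm_mul_le hμ S T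
      _ = _ := by ring
  · refine (l2norm_ES_le_avg hμ R _).trans ?_
    calc _ ≤ 2 ^ k * ((2 ^ k) ^ 2 * (η * N)) :=
          mul_le_mul (two_pow_card_le R) (ha.norm_avg_mul_le hμ h1) (l2norm_nonneg _ _)
            (by positivity)
      _ = _ := by ring

end ESFamily

/-- Pairs of sets whose product of components contributes substantially to level `R`. -/
def goodPairs (R : Finset (Fin k)) : Finset (Finset (Fin k) × Finset (Fin k)) :=
  univ.filter fun p => symmDiff p.1 p.2 ⊆ R ∧ R ⊆ p.1 ∪ p.2

/-- Pairs of sets with union `R`. -/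
def coverPairs (R : Finset (Fin k)) : Finset (Finset (Fin k) × Finset (Fin k)) :=
  univ.filter fun t => t.1 ∪ t.2 = R

/-- Good pairs with prescribed traces on `R`. -/
def goodFiber (R : Finset (Fin k)) (t : Finset (Fin k) × Finset (Fin k)) :
    Finset (Finset (Fin k) × Finset (Fin k)) :=
  (goodPairs R).filter fun p => (p.1 ∩ R, p.2 ∩ R) = t

/-- The sum of squares of the components above `T`. -/
def upSq (a : Finset (Fin k) → (∀ i, V i) → ℝ) (T : Finset (Fin k)) : (∀ i, V i) → ℝ :=
  ∑ S ∈ univ.filter (fun S : Finset (Fin k) => T ⊆ S), a S ^ 2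

lemma upSq_apply (a : Finset (Fin k) → (∀ i, V i) → ℝ) (T : Finset (Fin k)) (x : ∀ i, V i) :
    upSq a T x = ∑ S ∈ univ.filter (fun S : Finset (Fin k) => T ⊆ S), a S x ^ 2 := by
  simp [upSq]

lemma upSq_nonneg (a : Finset (Fin k) → (∀ i, V i) → ℝ) (T : Finset (Fin k))
    (x : ∀ i, V i) : 0 ≤ upSq a T x := by
  rw [upSq_apply]
  exact Finset.sum_nonneg fun _ _ => sq_nonneg _

lemma card_pairs_le (s : Finset (Finset (Fin k) × Finset (Fin k))) :
    (s.card : ℝ) ≤ (2 ^ k) ^ 2 := by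
  have : s.card ≤ (2 ^ k) ^ 2 := by
    refine (Finset.card_le_univ s).trans (le_of_eq ?_)
    simp [Fintype.card_prod, sq]
  exact_mod_cast this

lemma card_coverPairs_le (R : Finset (Fin k)) :
    ((coverPairs R).card : ℝ) ≤ (2 ^ R.card) ^ 2 := by
  have : (coverPairs R).card ≤ (2 ^ R.card) ^ 2 := by
    have hsub : coverPairs R ⊆ R.powerset ×ˢ R.powerset := by
      rintro ⟨t1, t2⟩ h
      have h' : t1 ∪ t2 = R := by simpa [coverPairs] using h
      rw [Finset.mem_product, Finset.mem_powerset, Finset.mem_powerset, ← h']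
      exact ⟨Finset.subset_union_left, Finset.subset_union_right⟩
    refine (Finset.card_le_card hsub).trans (le_of_eq ?_)
    rw [Finset.card_product, Finset.card_powerset, sq]
  exact_mod_cast this

lemma sum_goodPairs_eq {E : Type*} [AddCommMonoid E] (R : Finset (Fin k))
    (F : Finset (Fin k) × Finset (Fin k) → E) :
    ∑ p ∈ goodPairs R, F p = ∑ t ∈ coverPairs R, ∑ p ∈ goodFiber R t, F p := by
  refine (Finset.sum_fiberwise_of_maps_to (fun p hp => ?_) F).symm
  simp only [goodPairs, Finset.mem_filter, Finset.mem_univ, true_and] at hp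
  simp only [coverPairs, Finset.mem_filter, Finset.mem_univ, true_and]
  rw [← Finset.union_inter_distrib_right]
  exact Finset.inter_eq_right.2 hp.2

lemma mem_goodFiber {R : Finset (Fin k)} {t p : Finset (Fin k) × Finset (Fin k)} :
    p ∈ goodFiber R t ↔
      (symmDiff p.1 p.2 ⊆ R ∧ R ⊆ p.1 ∪ p.2) ∧ p.1 ∩ R = t.1 ∧ p.2 ∩ R = t.2 := by
  simp [goodFiber, goodPairs, Prod.ext_iff]

lemma goodFiber_fst_injOn (R : Finset (Fin k)) (t : Finset (Fin k) × Finset (Fin k)) :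
    Set.InjOn Prod.fst (goodFiber R t : Set (Finset (Fin k) × Finset (Fin k))) := by
  rintro ⟨p1, p2⟩ hp ⟨q1, q2⟩ hq h
  rw [Finset.mem_coe, mem_goodFiber] at hp hq
  obtain rfl : p1 = q1 := h
  refine Prod.ext rfl ?_
  ext i
  have e : i ∈ p2 ∩ R ↔ i ∈ q2 ∩ R := by rw [hp.2.2, hq.2.2]
  have h1 := @hp.1.1 i
  have h2 := @hq.1.1 i
  simp only [Finset.mem_symmDiff, Finset.mem_inter] at e h1 h2
  tauto

lemma goodFiber_snd_injOn (R : Finset (Fin k)) (t : Finset (Fin k) × Finset (Fin k)) :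
    Set.InjOn Prod.snd (goodFiber R t : Set (Finset (Fin k) × Finset (Fin k))) := by
  rintro ⟨p1, p2⟩ hp ⟨q1, q2⟩ hq h
  rw [Finset.mem_coe, mem_goodFiber] at hp hq
  obtain rfl : p2 = q2 := h
  refine Prod.ext ?_ rfl
  ext i
  have e : i ∈ p1 ∩ R ↔ i ∈ q1 ∩ R := by rw [hp.2.1, hq.2.1]
  have h1 := @hp.1.1 i
  have h2 := @hq.1.1 i
  simp only [Finset.mem_symmDiff, Finset.mem_inter] at e h1 h2
  tauto

lemma sum_sq_le_upSq (a : Finset (Fin k) → (∀ i, V i) → ℝ) {ι : Type*} (s : Finset ι)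
    (φ : ι → Finset (Fin k)) (hφ : Set.InjOn φ s) {T : Finset (Fin k)}
    (h : ∀ p ∈ s, T ⊆ φ p) (x : ∀ i, V i) :
    (∑ p ∈ s, a (φ p) ^ 2) x ≤ upSq a T x := by
  rw [upSq_apply, Finset.sum_apply]
  simp only [Pi.pow_apply]
  rw [← Finset.sum_image (f := fun S => a S x ^ 2) hφ]
  refine Finset.sum_le_sum_of_subset_of_nonneg (fun S hS => ?_) fun _ _ _ => sq_nonneg _
  obtain ⟨p, hp, rfl⟩ := Finset.mem_image.1 hS
  simpa using h p hp

lemma inner'_avg_mono {μ : (∀ i, V i) → ℝ} (hμ : IsProb μ) (B : Finset (Fin k))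
    {f f' g g' : (∀ i, V i) → ℝ} (hf : ∀ x, f x ≤ f' x) (hg : ∀ x, g x ≤ g' x)
    (hf0 : ∀ x, 0 ≤ f' x) (hg0 : ∀ x, 0 ≤ g x) :
    inner' μ (avg μ B f) (avg μ B g) ≤ inner' μ (avg μ B f') (avg μ B g') := by
  refine le_trans ?_ (inner'_mono_right hμ (avg_nonneg hμ B hf0) fun x _ => avg_mono hμ B hg x)
  rw [inner'_comm, inner'_comm μ (avg μ B f')]
  exact inner'_mono_right hμ (avg_nonneg hμ B hg0) fun x _ => avg_mono hμ B hf x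

lemma ES_add (μ : (∀ i, V i) → ℝ) (S : Finset (Fin k)) (f g : (∀ i, V i) → ℝ) :
    ES μ S (f + g) = ES μ S f + ES μ S g := by
  simp only [ES_eq_alt, alt, map_add, smul_add, Finset.sum_add_distrib]

lemma l2norm_avg_sum_mul_sq_le {μ : (∀ i, V i) → ℝ} (hμ : IsProb μ) (R : Finset (Fin k))
    {ι : Type*} (s : Finset ι) (u v : ι → (∀ i, V i) → ℝ) :
    l2norm μ (avg μ R (∑ j ∈ s, u j * v j)) ^ 2 ≤
      inner' μ (avg μ R (∑ j ∈ s, u j ^ 2)) (avg μ R (∑ j ∈ s, v j ^ 2)) := by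
  rw [l2norm_sq hμ]
  refine Finset.sum_le_sum fun x _ => mul_le_mul_of_nonneg_left ?_ (hμ.1 x)
  rw [← sq]
  exact avg_sum_mul_sq_le hμ R s u v x

namespace ESFamily

variable {μ : (∀ i, V i) → ℝ} {η N : ℝ} {a : Finset (Fin k) → (∀ i, V i) → ℝ}

lemma inner'_avg_sq_le (ha : ESFamily μ η N a) (hμ : IsProb μ) (hη : 0 ≤ η)
    (hC : AlmostCommute μ η) (R S T : Finset (Fin k)) :
    inner' μ (avg μ R (a S ^ 2)) (avg μ R (a T ^ 2)) ≤
      inner' μ (avg μ ((S ∩ R) ∩ (T ∩ R)) (a S ^ 2)) (avg μ ((S ∩ R) ∩ (T ∩ R)) (a T ^ 2)) +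
        2 * (2 ^ k) ^ 4 * η * N ^ 2 := by
  have hj : ∀ S, Junta S (a S ^ 2) := fun S => by
    rw [sq]; exact (ha.junta S).mul (ha.junta S)
  have hn : ∀ S, l2norm μ (a S ^ 2) ≤ (2 ^ k) ^ 2 * N := fun S => by
    rw [sq]; exact ha.norm_mul_le hμ S S
  have h1 := (abs_le.1 (abs_inner'_avg_sub_le hμ hC R (hj S) (hj T))).2
  have h2 : 2 * η * (l2norm μ (a S ^ 2) * l2norm μ (a T ^ 2)) ≤
      2 * η * (((2 ^ k) ^ 2 * N) * ((2 ^ k) ^ 2 * N)) := by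
    refine mul_le_mul_of_nonneg_left ?_ (by positivity)
    exact mul_le_mul (hn S) (hn T) (l2norm_nonneg _ _) ((l2norm_nonneg _ _).trans (hn S))
  linarith

lemma norm_avg_fiber_sq_le (ha : ESFamily μ η N a) (hμ : IsProb μ) (hη : 0 ≤ η)
    (hC : AlmostCommute μ η) (R : Finset (Fin k)) (t : Finset (Fin k) × Finset (Fin k)) :
    l2norm μ (avg μ R (∑ p ∈ goodFiber R t, a p.1 * a p.2)) ^ 2 ≤
      inner' μ (avg μ (t.1 ∩ t.2) (upSq a t.1)) (avg μ (t.1 ∩ t.2) (upSq a t.2)) +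
        2 * (2 ^ k) ^ 8 * η * N ^ 2 := by
  have hmono : inner' μ (avg μ (t.1 ∩ t.2) (∑ p ∈ goodFiber R t, a p.1 ^ 2))
      (avg μ (t.1 ∩ t.2) (∑ p ∈ goodFiber R t, a p.2 ^ 2)) ≤
      inner' μ (avg μ (t.1 ∩ t.2) (upSq a t.1)) (avg μ (t.1 ∩ t.2) (upSq a t.2)) := by
    refine inner'_avg_mono hμ _ ?_ ?_ (upSq_nonneg a _) fun x => ?_
    · refine sum_sq_le_upSq a _ _ (goodFiber_fst_injOn R t) fun p hp => ?_
      rw [← (mem_goodFiber.1 hp).2.1]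
      exact Finset.inter_subset_left
    · refine sum_sq_le_upSq a _ _ (goodFiber_snd_injOn R t) fun p hp => ?_
      rw [← (mem_goodFiber.1 hp).2.2]
      exact Finset.inter_subset_left
    · rw [Finset.sum_apply]
      exact Finset.sum_nonneg fun p _ => sq_nonneg _
  refine (l2norm_avg_sum_mul_sq_le hμ R (goodFiber R t) _ _).trans ?_
  refine le_trans ?_ (add_le_add_left hmono _)
  simp only [map_sum, inner'_sum_left, inner'_sum_right]
  have hterm : ∀ p ∈ goodFiber R t, ∀ q ∈ goodFiber R t,
      inner' μ (avg μ R (a q.1 ^ 2)) (avg μ R (a p.2 ^ 2)) ≤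
        inner' μ (avg μ (t.1 ∩ t.2) (a q.1 ^ 2)) (avg μ (t.1 ∩ t.2) (a p.2 ^ 2)) +
          2 * (2 ^ k) ^ 4 * η * N ^ 2 := fun p hp q hq => by
    have := ha.inner'_avg_sq_le hμ hη hC R q.1 p.2
    rwa [(mem_goodFiber.1 hq).2.1, (mem_goodFiber.1 hp).2.2] at this
  refine (Finset.sum_le_sum fun p hp => Finset.sum_le_sum (hterm p hp)).trans ?_
  simp only [Finset.sum_add_distrib, Finset.sum_const, nsmul_eq_mul]
  have hc := card_pairs_le (goodFiber R t)
  have : ((goodFiber R t).card : ℝ) * ((goodFiber R t).card * (2 * (2 ^ k) ^ 4 * η * N ^ 2)) ≤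
      (2 ^ k) ^ 2 * ((2 ^ k) ^ 2 * (2 * (2 ^ k) ^ 4 * η * N ^ 2)) := by gcongr
  linarith

lemma norm_ES_sum_sq_le (ha : ESFamily μ η N a) (hμ : IsProb μ) (hη : 0 ≤ η)
    (hC : AlmostCommute μ η) (R : Finset (Fin k)) :
    l2norm μ (ES μ R (∑ p ∈ goodPairs R, a p.1 * a p.2)) ^ 2 ≤
      16 ^ R.card * ∑ t ∈ coverPairs R,
        (inner' μ (avg μ (t.1 ∩ t.2) (upSq a t.1)) (avg μ (t.1 ∩ t.2) (upSq a t.2)) +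
          2 * (2 ^ k) ^ 8 * η * N ^ 2) := by
  have h1 := l2norm_ES_le_avg hμ R (∑ p ∈ goodPairs R, a p.1 * a p.2)
  have h2 : l2norm μ (avg μ R (∑ p ∈ goodPairs R, a p.1 * a p.2)) ≤
      ∑ t ∈ coverPairs R, l2norm μ (avg μ R (∑ p ∈ goodFiber R t, a p.1 * a p.2)) := by
    rw [sum_goodPairs_eq, map_sum]
    exact l2norm_sum_le hμ _ _
  have h3 := sq_sum_le_card_mul_sum_sq (s := coverPairs R)
    (f := fun t => l2norm μ (avg μ R (∑ p ∈ goodFiber R t, a p.1 * a p.2)))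
  have h4 := Finset.sum_le_sum fun t (_ : t ∈ coverPairs R) =>
    ha.norm_avg_fiber_sq_le hμ hη hC R t
  have h5 := card_coverPairs_le R
  have h6 := l2norm_nonneg μ (avg μ R (∑ p ∈ goodPairs R, a p.1 * a p.2))
  have h7 : (0 : ℝ) ≤ ∑ t ∈ coverPairs R,
      l2norm μ (avg μ R (∑ p ∈ goodFiber R t, a p.1 * a p.2)) ^ 2 :=
    Finset.sum_nonneg fun _ _ => sq_nonneg _
  have h16 : (16 : ℝ) ^ R.card = (2 ^ R.card) ^ 2 * (2 ^ R.card) ^ 2 := by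
    rw [← pow_add, ← pow_mul, mul_comm, pow_mul]
    norm_num
  calc _ ≤ (2 ^ R.card * l2norm μ (avg μ R (∑ p ∈ goodPairs R, a p.1 * a p.2))) ^ 2 :=
        pow_le_pow_left₀ (l2norm_nonneg _ _) h1 2
    _ = (2 ^ R.card) ^ 2 * l2norm μ (avg μ R (∑ p ∈ goodPairs R, a p.1 * a p.2)) ^ 2 := by
        ring
    _ ≤ (2 ^ R.card) ^ 2 * ((2 ^ R.card) ^ 2 * ∑ t ∈ coverPairs R,
          l2norm μ (avg μ R (∑ p ∈ goodFiber R t, a p.1 * a p.2)) ^ 2) := by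
        refine mul_le_mul_of_nonneg_left ?_ (by positivity)
        exact (pow_le_pow_left₀ h6 h2 2).trans (h3.trans (mul_le_mul_of_nonneg_right h5 h7))
    _ = 16 ^ R.card * ∑ t ∈ coverPairs R,
          l2norm μ (avg μ R (∑ p ∈ goodFiber R t, a p.1 * a p.2)) ^ 2 := by
        rw [h16]; ring
    _ ≤ _ := mul_le_mul_of_nonneg_left h4 (by positivity)

lemma sum_mul_sum_eq (a : Finset (Fin k) → (∀ i, V i) → ℝ) :
    (∑ S, a S) * (∑ S, a S) = ∑ p : Finset (Fin k) × Finset (Fin k), a p.1 * a p.2 := by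
  rw [Finset.sum_mul_sum, ← Finset.univ_product_univ, Finset.sum_product]

lemma norm_sq_sum_le (ha : ESFamily μ η N a) (hμ : IsProb μ) :
    l2norm μ ((∑ S, a S) * (∑ S, a S)) ≤ (2 ^ k) ^ 4 * N := by
  rw [sum_mul_sum_eq]
  refine (l2norm_sum_le_card hμ _ _ fun p _ => ha.norm_mul_le hμ p.1 p.2).trans ?_
  have := mul_le_mul_of_nonneg_right
    (card_pairs_le (univ : Finset (Finset (Fin k) × Finset (Fin k))))
    ((l2norm_nonneg _ _).trans (ha.norm_mul_le hμ ∅ ∅))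
  linarith

lemma norm_ES_sq_sum_le (ha : ESFamily μ η N a) (hμ : IsProb μ) (hη : 0 ≤ η)
    (hC : AlmostCommute μ η) (hN : 0 ≤ N) (R : Finset (Fin k)) :
    l2norm μ (ES μ R ((∑ S, a S) * (∑ S, a S))) ≤
      l2norm μ (ES μ R (∑ p ∈ goodPairs R, a p.1 * a p.2)) + (2 ^ k) ^ 5 * (η * N) := by
  rw [sum_mul_sum_eq, ← Finset.sum_filter_add_sum_filter_not _
    (fun p : Finset (Fin k) × Finset (Fin k) => symmDiff p.1 p.2 ⊆ R ∧ R ⊆ p.1 ∪ p.2)]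
  rw [ES_add]
  refine (l2norm_add_le hμ _ _).trans (add_le_add le_rfl ?_)
  rw [ES_sum]
  refine (l2norm_sum_le_card hμ _ _ fun p hp =>
    ha.norm_ES_mul_le hμ hη hC (Finset.mem_filter.1 hp).2).trans ?_
  refine (mul_le_mul_of_nonneg_right (card_pairs_le _) (by positivity)).trans (le_of_eq ?_)
  ring

theorem norm_sq_sum_sq_le (ha : ESFamily μ η N a) (hμ : IsProb μ) (hη : 0 ≤ η) (hη1 : η ≤ 1)
    (hC : AlmostCommute μ η) (hN : 0 ≤ N) :
    l2norm μ ((∑ S, a S) * (∑ S, a S)) ^ 2 ≤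
      2 * ∑ t : Finset (Fin k) × Finset (Fin k), 16 ^ (t.1 ∪ t.2).card *
        inner' μ (avg μ (t.1 ∩ t.2) (upSq a t.1)) (avg μ (t.1 ∩ t.2) (upSq a t.2)) +
      7 * (2 ^ k) ^ 15 * η * N ^ 2 := by
  set G := (∑ S, a S) * (∑ S, a S) with hG
  set D : Finset (Fin k) × Finset (Fin k) → ℝ := fun t =>
    inner' μ (avg μ (t.1 ∩ t.2) (upSq a t.1)) (avg μ (t.1 ∩ t.2) (upSq a t.2)) with hD
  have hM : (1 : ℝ) ≤ 2 ^ k := one_le_pow₀ one_le_two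
  have h1 := (abs_le.1 (abs_l2norm_sq_sub_sum_ES_le hμ hη hC G)).2
  have h2 : l2norm μ G ^ 2 ≤ ((2 ^ k) ^ 4 * N) ^ 2 :=
    pow_le_pow_left₀ (l2norm_nonneg _ _) (ha.norm_sq_sum_le hμ) 2
  have h3 : ∀ R : Finset (Fin k), l2norm μ (ES μ R G) ^ 2 ≤
      2 * ∑ t ∈ coverPairs R, 16 ^ (t.1 ∪ t.2).card * D t +
        6 * (2 ^ k) ^ 14 * η * N ^ 2 := fun R => by
    have h4 := pow_le_pow_left₀ (l2norm_nonneg _ _) (ha.norm_ES_sq_sum_le hμ hη hC hN R) 2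
    have h5 := ha.norm_ES_sum_sq_le hμ hη hC R
    rw [Finset.sum_add_distrib, mul_add, Finset.mul_sum, Finset.sum_const, nsmul_eq_mul] at h5
    have h6 : ∑ t ∈ coverPairs R, (16 : ℝ) ^ R.card * D t =
        ∑ t ∈ coverPairs R, 16 ^ (t.1 ∪ t.2).card * D t :=
      Finset.sum_congr rfl fun t ht => by rw [(Finset.mem_filter.1 ht).2]
    rw [h6] at h5
    have h16 : (16 : ℝ) ^ R.card ≤ (2 ^ k) ^ 4 := by
      rw [← pow_mul, mul_comm, pow_mul]
      norm_num
      exact pow_le_pow_right₀ (by norm_num) (by simpa using Finset.card_le_univ R)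
    have h7 : (16 : ℝ) ^ R.card * ((coverPairs R).card * (2 * (2 ^ k) ^ 8 * η * N ^ 2)) ≤
        (2 ^ k) ^ 4 * ((2 ^ k) ^ 2 * (2 * (2 ^ k) ^ 8 * η * N ^ 2)) := by
      gcongr
      exact card_pairs_le _
    have h8 : 2 * ((2 ^ k) ^ 5 * (η * N)) ^ 2 ≤ 2 * (2 ^ k) ^ 14 * η * N ^ 2 := by
      have : ((2 : ℝ) ^ k) ^ 10 ≤ (2 ^ k) ^ 14 := pow_le_pow_right₀ hM (by norm_num)
      have h9 : η ^ 2 ≤ η := by nlinarith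
      calc _ = 2 * ((2 ^ k) ^ 10 * η ^ 2 * N ^ 2) := by ring
        _ ≤ 2 * ((2 ^ k) ^ 14 * η * N ^ 2) := by gcongr
        _ = _ := by ring
    have h10 := add_sq_le (a := l2norm μ (ES μ R (∑ p ∈ goodPairs R, a p.1 * a p.2)))
      (b := (2 ^ k) ^ 5 * (η * N))
    nlinarith
  have h11 := Finset.sum_le_sum fun R (_ : R ∈ (univ : Finset (Finset (Fin k)))) => h3 R
  have h12 : ∑ R : Finset (Fin k), ∑ t ∈ coverPairs R, (16 : ℝ) ^ (t.1 ∪ t.2).card * D t =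
      ∑ t : Finset (Fin k) × Finset (Fin k), 16 ^ (t.1 ∪ t.2).card * D t :=
    Finset.sum_fiberwise univ (fun t : Finset (Fin k) × Finset (Fin k) => t.1 ∪ t.2) _
  rw [Finset.sum_add_distrib, ← Finset.mul_sum, h12, Finset.sum_const, nsmul_eq_mul,
    card_univ_finset] at h11
  have h13 : (2 ^ k) ^ 4 * η * l2norm μ G ^ 2 ≤ (2 ^ k) ^ 15 * η * N ^ 2 := by
    have : ((2 : ℝ) ^ k) ^ 12 ≤ (2 ^ k) ^ 15 := pow_le_pow_right₀ hM (by norm_num)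
    calc _ ≤ (2 ^ k) ^ 4 * η * ((2 ^ k) ^ 4 * N) ^ 2 := by gcongr
      _ = (2 ^ k) ^ 12 * η * N ^ 2 := by ring
      _ ≤ _ := by gcongr
  linarith

end ESFamily

/-! ### The fourth moment of the low-degree part of a global function -/

lemma inner'_nonneg {μ : (∀ i, V i) → ℝ} (hμ : IsProb μ) {f g : (∀ i, V i) → ℝ}
    (hf : ∀ x, 0 ≤ f x) (hg : ∀ x, 0 ≤ g x) : 0 ≤ inner' μ f g :=
  Finset.sum_nonneg fun x _ => mul_nonneg (hμ.1 x) (mul_nonneg (hf x) (hg x))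

lemma upSq_eq_zero {a : Finset (Fin k) → (∀ i, V i) → ℝ} {m : ℕ}
    (h : ∀ S, m < S.card → a S = 0) {T : Finset (Fin k)} (hT : m < T.card) : upSq a T = 0 := by
  refine Finset.sum_eq_zero fun S hS => ?_
  rw [h S (hT.trans_le (Finset.card_le_card (Finset.mem_filter.1 hS).2)), sq, zero_mul]

lemma sum_upSq_le {a : Finset (Fin k) → (∀ i, V i) → ℝ} {m : ℕ}
    (h : ∀ S, m < S.card → a S = 0) (B : Finset (Fin k)) (x : ∀ i, V i) :
    (∑ T ∈ univ.filter (fun T : Finset (Fin k) => B ⊆ T), upSq a T) x ≤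
      ((2 : ℝ) ^ m • upSq a B) x := by
  rw [Finset.sum_apply, Pi.smul_apply, smul_eq_mul]
  simp only [upSq_apply]
  rw [Finset.sum_comm' (t' := univ.filter (fun S : Finset (Fin k) => B ⊆ S))
    (s' := fun S => univ.filter (fun T : Finset (Fin k) => B ⊆ T ∧ T ⊆ S)), Finset.mul_sum]
  · refine Finset.sum_le_sum fun S _ => ?_
    rw [Finset.sum_const, nsmul_eq_mul]
    rcases lt_or_ge m S.card with hS | hS
    · simp [h S hS]
    · refine mul_le_mul_of_nonneg_right ?_ (sq_nonneg _)
      have h1 : (univ.filter (fun T : Finset (Fin k) => B ⊆ T ∧ T ⊆ S)).card ≤ 2 ^ S.card := by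
        rw [← Finset.card_powerset]
        exact Finset.card_le_card fun T hT => Finset.mem_powerset.2 (Finset.mem_filter.1 hT).2.2
      exact_mod_cast h1.trans (Nat.pow_le_pow_right two_pos hS)
  · intro T S
    simp only [Finset.mem_filter, Finset.mem_univ, true_and]
    exact ⟨fun h => ⟨⟨h.1, h.2⟩, h.1.trans h.2⟩, fun h => h.1⟩

lemma sum_inner'_avg_upSq_le {μ : (∀ i, V i) → ℝ} (hμ : IsProb μ)
    {a : Finset (Fin k) → (∀ i, V i) → ℝ} {m : ℕ} (h : ∀ S, m < S.card → a S = 0) :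
    ∑ t : Finset (Fin k) × Finset (Fin k), 16 ^ (t.1 ∪ t.2).card *
        inner' μ (avg μ (t.1 ∩ t.2) (upSq a t.1)) (avg μ (t.1 ∩ t.2) (upSq a t.2)) ≤
      1024 ^ m * ∑ B : Finset (Fin k), inner' μ (avg μ B (upSq a B)) (avg μ B (upSq a B)) := by
  have hD : ∀ B T T' : Finset (Fin k),
      0 ≤ inner' μ (avg μ B (upSq a T)) (avg μ B (upSq a T')) := fun B T T' =>
    inner'_nonneg hμ (avg_nonneg hμ B (upSq_nonneg a T)) (avg_nonneg hμ B (upSq_nonneg a T'))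
  have h1 : ∀ t : Finset (Fin k) × Finset (Fin k), 16 ^ (t.1 ∪ t.2).card *
      inner' μ (avg μ (t.1 ∩ t.2) (upSq a t.1)) (avg μ (t.1 ∩ t.2) (upSq a t.2)) ≤
      256 ^ m * inner' μ (avg μ (t.1 ∩ t.2) (upSq a t.1)) (avg μ (t.1 ∩ t.2) (upSq a t.2)) := by
    intro t
    rcases lt_or_ge m t.1.card with h1 | h1
    · simp [upSq_eq_zero h h1, inner']
    rcases lt_or_ge m t.2.card with h2 | h2
    · simp [upSq_eq_zero h h2, inner']
    refine mul_le_mul_of_nonneg_right ?_ (hD _ _ _)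
    have h3 : (256 : ℝ) ^ m = 16 ^ (2 * m) := by rw [pow_mul]; norm_num
    rw [h3]
    refine pow_le_pow_right₀ (by norm_num) ((Finset.card_union_le _ _).trans (by omega))
  have h2 : ∀ B : Finset (Fin k), ∑ t ∈ univ.filter
      (fun t : Finset (Fin k) × Finset (Fin k) => t.1 ∩ t.2 = B),
        inner' μ (avg μ (t.1 ∩ t.2) (upSq a t.1)) (avg μ (t.1 ∩ t.2) (upSq a t.2)) ≤
      4 ^ m * inner' μ (avg μ B (upSq a B)) (avg μ B (upSq a B)) := by
    intro B
    calc _ = ∑ t ∈ univ.filter (fun t : Finset (Fin k) × Finset (Fin k) => t.1 ∩ t.2 = B),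
          inner' μ (avg μ B (upSq a t.1)) (avg μ B (upSq a t.2)) :=
          Finset.sum_congr rfl fun t ht => by rw [(Finset.mem_filter.1 ht).2]
      _ ≤ ∑ t ∈ (univ.filter (fun T : Finset (Fin k) => B ⊆ T)) ×ˢ
            (univ.filter (fun T : Finset (Fin k) => B ⊆ T)),
          inner' μ (avg μ B (upSq a t.1)) (avg μ B (upSq a t.2)) := by
          refine Finset.sum_le_sum_of_subset_of_nonneg (fun t ht => ?_) fun _ _ _ => hD _ _ _
          have := (Finset.mem_filter.1 ht).2
          simp [← this, Finset.inter_subset_left, Finset.inter_subset_right]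
      _ = inner' μ (avg μ B (∑ T ∈ univ.filter (fun T : Finset (Fin k) => B ⊆ T), upSq a T))
            (avg μ B (∑ T ∈ univ.filter (fun T : Finset (Fin k) => B ⊆ T), upSq a T)) := by
          simp only [map_sum, inner'_sum_left, inner'_sum_right, Finset.sum_product]
          exact Finset.sum_comm
      _ ≤ inner' μ (avg μ B ((2 : ℝ) ^ m • upSq a B)) (avg μ B ((2 : ℝ) ^ m • upSq a B)) := by
          refine inner'_avg_mono hμ B (sum_upSq_le h B) (sum_upSq_le h B) (fun x => ?_) fun x => ?_
          · exact mul_nonneg (by positivity) (upSq_nonneg a B x)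
          · rw [Finset.sum_apply]
            exact Finset.sum_nonneg fun T _ => upSq_nonneg a T x
      _ = _ := by
          rw [map_smul, inner'_smul_left, inner'_smul_right, ← mul_assoc, ← mul_pow]
          norm_num
  refine (Finset.sum_le_sum fun t _ => h1 t).trans ?_
  rw [← Finset.mul_sum, ← Finset.sum_fiberwise univ
    (fun t : Finset (Fin k) × Finset (Fin k) => t.1 ∩ t.2)]
  have h3 := mul_le_mul_of_nonneg_left
    (Finset.sum_le_sum fun B (_ : B ∈ (univ : Finset (Finset (Fin k)))) => h2 B)
    (by positivity : (0 : ℝ) ≤ 256 ^ m)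
  rw [← Finset.mul_sum, ← mul_assoc, ← mul_pow] at h3
  norm_num at h3 ⊢
  exact h3

lemma sum_alt_of_subset {E : Type*} [AddCommGroup E] [Module ℝ E]
    (φ : Finset (Fin k) → E) (U B : Finset (Fin k)) (hB : B ⊆ U) :
    ∑ S ∈ U.powerset.filter (fun S => B ⊆ S), alt φ S =
      ∑ C ∈ B.powerset, (-1 : ℝ) ^ C.card • φ (U \ C) := by
  induction B using Finset.induction_on generalizing U with
  | empty => simp [sum_alt]
  | insert a B ha ih =>
    have hBU : B ⊆ U := (Finset.subset_insert a B).trans hB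
    have hBU' : B ⊆ U.erase a := fun i hi =>
      Finset.mem_erase.2 ⟨by rintro rfl; exact ha hi, hBU hi⟩
    have e1 : (U.powerset.filter (fun S => B ⊆ S)).filter (fun S => a ∈ S) =
        U.powerset.filter (fun S => insert a B ⊆ S) := by
      ext S; simp [Finset.insert_subset_iff]; tauto
    have e2 : (U.powerset.filter (fun S => B ⊆ S)).filter (fun S => a ∉ S) =
        (U.erase a).powerset.filter (fun S => B ⊆ S) := by
      ext S; simp [Finset.subset_erase]; tauto
    have h1 := Finset.sum_filter_add_sum_filter_not (U.powerset.filter (fun S => B ⊆ S))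
      (fun S => a ∈ S) (alt φ)
    rw [e1, e2, ih U hBU, ih (U.erase a) hBU'] at h1
    rw [eq_sub_of_add_eq h1, Finset.sum_powerset_insert ha, sub_eq_add_neg,
      ← Finset.sum_neg_distrib]
    congr 1
    refine Finset.sum_congr rfl fun C hC => ?_
    have haC : a ∉ C := fun h => ha (Finset.mem_powerset.1 hC h)
    rw [Finset.card_insert_of_notMem haC, pow_succ, mul_neg_one, neg_smul]
    congr 3
    ext i; simp; tauto

lemma sum_ES_sq_le (μ : (∀ i, V i) → ℝ) (B : Finset (Fin k)) (f : (∀ i, V i) → ℝ)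
    (x : ∀ i, V i) :
    (∑ S ∈ univ.filter (fun S : Finset (Fin k) => B ⊆ S), ES μ S f) x ^ 2 ≤
      2 ^ B.card * ∑ C ∈ B.powerset, avg μ Cᶜ f x ^ 2 := by
  have h := sum_alt_of_subset (fun T => avg μ T f) univ B (Finset.subset_univ B)
  rw [Finset.powerset_univ] at h
  simp only [ES_eq_alt]
  rw [h, Finset.sum_apply]
  simp only [Pi.smul_apply, smul_eq_mul]
  refine sq_sum_le_card_mul_sum_sq.trans (le_of_eq ?_)
  rw [Finset.card_powerset]
  push_cast
  congr 1
  refine Finset.sum_congr rfl fun C _ => ?_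
  rw [mul_pow, ← pow_mul, mul_comm C.card 2, pow_mul, neg_one_sq, one_pow, one_mul,
    Finset.compl_eq_univ_sdiff]

/-- The Efron–Stein components of degree at most `m`. -/
noncomputable def lowES (μ : (∀ i, V i) → ℝ) (m : ℕ) (f : (∀ i, V i) → ℝ)
    (S : Finset (Fin k)) : (∀ i, V i) → ℝ :=
  if S.card ≤ m then ES μ S f else 0

lemma esFamily_ES {μ : (∀ i, V i) → ℝ} {η : ℝ} (hμ : IsProb μ) (hη : 0 ≤ η)
    (hC : AlmostCommute μ η) {f : (∀ i, V i) → ℝ} (hf : ∀ x, |f x| ≤ 1) :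
    ESFamily μ η (l2norm μ f) (fun S => ES μ S f) where
  junta S := junta_ES μ S f
  abs_apply_le S x := abs_ES_le hμ S hf x
  norm_le S := l2norm_ES_le hμ S f
  norm_avg_erase_le _ _ hi := l2norm_avg_erase_ES_le hμ hη hC hi f

lemma esFamily_lowES {μ : (∀ i, V i) → ℝ} {η : ℝ} (hμ : IsProb μ) (hη : 0 ≤ η)
    (hC : AlmostCommute μ η) {f : (∀ i, V i) → ℝ} (hf : ∀ x, |f x| ≤ 1) (m : ℕ) :
    ESFamily μ η (l2norm μ f) (lowES μ m f) := by
  have hF := esFamily_ES hμ hη hC hf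
  have h0 := l2norm_nonneg μ f
  refine ⟨fun S => ?_, fun S x => ?_, fun S => ?_, fun S i hi => ?_⟩ <;> unfold lowES <;>
    split_ifs
  · exact hF.junta S
  · exact fun _ _ _ => rfl
  · exact hF.abs_apply_le S x
  · simp
  · exact hF.norm_le S
  · rw [l2norm_zero]; positivity
  · exact hF.norm_avg_erase_le S i hi
  · rw [map_zero, l2norm_zero]; positivity

lemma lowES_sq_le (μ : (∀ i, V i) → ℝ) (m : ℕ) (f : (∀ i, V i) → ℝ) (S : Finset (Fin k))
    (x : ∀ i, V i) : lowES μ m f S x ^ 2 ≤ ES μ S f x ^ 2 := by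
  unfold lowES
  split_ifs
  · exact le_rfl
  · simpa using sq_nonneg _

lemma lowES_eq_zero (μ : (∀ i, V i) → ℝ) {m : ℕ} (f : (∀ i, V i) → ℝ) (S : Finset (Fin k))
    (h : m < S.card) : lowES μ m f S = 0 := if_neg (not_le.2 h)

lemma upSq_lowES_le (μ : (∀ i, V i) → ℝ) (m : ℕ) (f : (∀ i, V i) → ℝ) (B : Finset (Fin k))
    (x : ∀ i, V i) : upSq (lowES μ m f) B x ≤ upSq (fun S => ES μ S f) B x := by
  rw [upSq_apply, upSq_apply]
  exact Finset.sum_le_sum fun S _ => lowES_sq_le μ m f S x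

lemma ESFamily.norm_upSq_le {μ : (∀ i, V i) → ℝ} {η N : ℝ}
    {a : Finset (Fin k) → (∀ i, V i) → ℝ} (ha : ESFamily μ η N a) (hμ : IsProb μ)
    (B : Finset (Fin k)) : l2norm μ (upSq a B) ≤ (2 ^ k) ^ 3 * N := by
  have h := fun S => ha.norm_mul_le hμ S S
  simp only [← sq] at h
  refine (l2norm_sum_le_card hμ _ _ fun S _ => h S).trans ?_
  have h1 : ((univ.filter fun S : Finset (Fin k) => B ⊆ S).card : ℝ) ≤ 2 ^ k := by
    rw [← card_univ_finset]
    exact_mod_cast Finset.card_le_univ _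
  have := mul_le_mul_of_nonneg_right h1 ((l2norm_nonneg _ _).trans (h ∅))
  linarith

/-- The off-diagonal part of the square of the components above `B`. -/
lemma ESFamily.exists_sq_sum_eq {μ : (∀ i, V i) → ℝ} {η N : ℝ}
    {a : Finset (Fin k) → (∀ i, V i) → ℝ} (ha : ESFamily μ η N a) (hμ : IsProb μ)
    (hη : 0 ≤ η) (hN : 0 ≤ N) (B : Finset (Fin k)) :
    ∃ r : (∀ i, V i) → ℝ,
      (∑ S ∈ univ.filter (fun S : Finset (Fin k) => B ⊆ S), a S) ^ 2 = upSq a B + r ∧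
        l2norm μ (avg μ B r) ≤ (2 ^ k) ^ 4 * (η * N) := by
  set s := univ.filter (fun S : Finset (Fin k) => B ⊆ S) with hs
  refine ⟨∑ p ∈ s.offDiag, a p.1 * a p.2, ?_, ?_⟩
  · rw [sq, Finset.sum_mul_sum, ← Finset.sum_product', ← Finset.diag_union_offDiag,
      Finset.sum_union (Finset.disjoint_diag_offDiag s), Finset.sum_diag]
    simp only [upSq, sq, hs]
  · rw [map_sum]
    refine (l2norm_sum_le_card hμ _ _ fun p hp => ha.norm_avg_mul_le hμ fun h => ?_).trans ?_
    · obtain ⟨h1, h2, h3⟩ := Finset.mem_offDiag.1 hp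
      refine h3 (Finset.ext fun i => ?_)
      have h1' : i ∈ B → i ∈ p.1 := fun hi => (Finset.mem_filter.1 h1).2 hi
      have h2' : i ∈ B → i ∈ p.2 := fun hi => (Finset.mem_filter.1 h2).2 hi
      have h' := @h i
      rw [Finset.mem_symmDiff] at h'
      tauto
    · refine (mul_le_mul_of_nonneg_right (card_pairs_le _) (by positivity)).trans (le_of_eq ?_)
      ring

lemma avg_le_of_isGlobal {μ : (∀ i, V i) → ℝ} (hμ : IsProb μ) {d : ℕ} {δ : ℝ} (hδ : 0 ≤ δ)
    {f : (∀ i, V i) → ℝ} (hf : ∀ x, f x = 0 ∨ f x = 1) (hG : IsGlobal μ d δ f)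
    {S : Finset (Fin k)} (hS : S.card ≤ d) {x : ∀ i, V i} (hx : μ x ≠ 0) :
    avg μ S f x ≤ δ ^ 2 := by
  have h := (Real.sqrt_le_left hδ).1 (hG S hS x (marg_pos hμ S hx))
  refine le_trans (le_of_eq ?_) h
  rw [avg_apply]
  refine Finset.sum_congr rfl fun z _ => ?_
  rcases hf z with h | h <;> simp [h]

lemma inner'_avg_upSq_le {μ : (∀ i, V i) → ℝ} {η : ℝ} (hμ : IsProb μ) (hη : 0 ≤ η)
    (hC : AlmostCommute μ η) {d m : ℕ} (hm : m ≤ d) {δ : ℝ} (hδ : 0 ≤ δ)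
    {f : (∀ i, V i) → ℝ} (hf : ∀ x, f x = 0 ∨ f x = 1) (hG : IsGlobal μ d δ f)
    (B : Finset (Fin k)) :
    inner' μ (avg μ B (upSq (lowES μ m f) B)) (avg μ B (upSq (lowES μ m f) B)) ≤
      4 ^ m * δ ^ 2 * inner' μ (upSq (lowES μ m f) B) 1 +
        2 * (2 ^ k) ^ 7 * η * l2norm μ f ^ 2 := by
  have hM : (1 : ℝ) ≤ 2 ^ k := one_le_pow₀ one_le_two
  set P := upSq (lowES μ m f) B with hP
  set N := l2norm μ f with hNdef
  have hN : 0 ≤ N := l2norm_nonneg μ f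
  have hP0 : ∀ x, 0 ≤ P x := upSq_nonneg _ _
  have hP1 : 0 ≤ inner' μ P 1 := inner'_nonneg hμ hP0 fun _ => zero_le_one
  rcases lt_or_ge m B.card with hB | hB
  · have : P = 0 := upSq_eq_zero (lowES_eq_zero μ f) hB
    have h0 : inner' μ (avg μ B P) (avg μ B P) = 0 := by simp [this, inner']
    rw [h0]
    positivity
  have hf1 : ∀ x, |f x| ≤ 1 := fun x => by rcases hf x with h | h <;> simp [h]
  have hF := esFamily_ES hμ hη hC hf1
  have hPn : l2norm μ P ≤ (2 ^ k) ^ 3 * N :=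
    (esFamily_lowES hμ hη hC hf1 m).norm_upSq_le hμ B
  obtain ⟨r, hr, hrn⟩ := hF.exists_sq_sum_eq hμ hη hN B
  set q := ∑ S ∈ univ.filter (fun S : Finset (Fin k) => B ⊆ S), ES μ S f with hq
  have h1 : inner' μ (avg μ B P) (avg μ B P) ≤
      inner' μ (avg μ B P) (avg μ B (upSq (fun S => ES μ S f) B)) :=
    inner'_mono_right hμ (avg_nonneg hμ B hP0) fun x _ => avg_mono hμ B (upSq_lowES_le μ m f B) x
  have h2 : inner' μ (avg μ B P) (avg μ B (upSq (fun S => ES μ S f) B)) =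
      inner' μ (avg μ B P) (q ^ 2) - inner' μ (avg μ B P) (avg μ B r) := by
    rw [← inner'_avg_eq hμ B P (q ^ 2), ← inner'_sub_right, ← map_sub, hr, add_sub_cancel_right]
  have h3 : - inner' μ (avg μ B P) (avg μ B r) ≤ (2 ^ k) ^ 7 * η * N ^ 2 := by
    refine (neg_le_abs _).trans ((abs_inner'_le hμ _ _).trans ?_)
    calc _ ≤ ((2 ^ k) ^ 3 * N) * ((2 ^ k) ^ 4 * (η * N)) :=
          mul_le_mul ((l2norm_avg_le hμ B P).trans hPn) hrn (l2norm_nonneg _ _) (by positivity)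
      _ = _ := by ring
  have h4 : inner' μ (avg μ B P) (q ^ 2) ≤
      inner' μ (avg μ B P) ((2 : ℝ) ^ B.card • ∑ C ∈ B.powerset, avg μ Cᶜ f) := by
    refine inner'_mono_right hμ (avg_nonneg hμ B hP0) fun x _ => ?_
    refine (sum_ES_sq_le μ B f x).trans ?_
    rw [Pi.smul_apply, smul_eq_mul, Finset.sum_apply]
    refine mul_le_mul_of_nonneg_left (Finset.sum_le_sum fun C _ => ?_) (by positivity)
    have hff : f ^ 2 = f := by
      ext y
      rcases hf y with h | h <;> simp [h]
    simpa only [hff] using avg_sq_le hμ Cᶜ f x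
  have h5 : ∀ C ∈ B.powerset, inner' μ (avg μ B P) (avg μ Cᶜ f) ≤
      δ ^ 2 * inner' μ P 1 + (2 ^ k) ^ 3 * η * N ^ 2 := fun C _ => by
    have e : inner' μ (avg μ B P) (avg μ Cᶜ f) =
        inner' μ P (avg μ B (avg μ Cᶜ f) - avg μ (B ∩ Cᶜ) f) + inner' μ P (avg μ (B ∩ Cᶜ) f) := by
      rw [inner'_avg, inner'_sub_right, sub_add_cancel]
    have h6 : inner' μ P (avg μ B (avg μ Cᶜ f) - avg μ (B ∩ Cᶜ) f) ≤
        ((2 ^ k) ^ 3 * N) * (η * N) :=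
      (le_abs_self _).trans ((abs_inner'_le hμ _ _).trans
        (mul_le_mul hPn (hC _ _ _) (l2norm_nonneg _ _) (by positivity)))
    have h7 : inner' μ P (avg μ (B ∩ Cᶜ) f) ≤ inner' μ P (δ ^ 2 • 1) := by
      refine inner'_mono_right hμ hP0 fun x hx => ?_
      simpa using avg_le_of_isGlobal hμ hδ hf hG
        ((Finset.card_le_card Finset.inter_subset_left).trans (hB.trans hm)) hx
    rw [inner'_smul_right] at h7
    rw [e]
    linarith
  have h8 := Finset.sum_le_sum h5
  rw [Finset.sum_const, Finset.card_powerset, nsmul_eq_mul] at h8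
  push_cast at h8
  rw [inner'_smul_right, inner'_sum_right] at h4
  have h9 := mul_le_mul_of_nonneg_left h8 (by positivity : (0 : ℝ) ≤ 2 ^ B.card)
  have h10 : (2 : ℝ) ^ B.card * (2 ^ B.card * (δ ^ 2 * inner' μ P 1)) ≤
      4 ^ m * (δ ^ 2 * inner' μ P 1) := by
    rw [← mul_assoc, ← mul_pow]
    norm_num
    refine mul_le_mul_of_nonneg_right (pow_le_pow_right₀ (by norm_num) hB) (by positivity)
  have h11 : (2 : ℝ) ^ B.card * (2 ^ B.card * ((2 ^ k) ^ 3 * η * N ^ 2)) ≤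
      (2 ^ k) ^ 7 * η * N ^ 2 := by
    have h12 := two_pow_card_le B
    have h13 : ((2 : ℝ) ^ k) ^ 5 ≤ (2 ^ k) ^ 7 := pow_le_pow_right₀ hM (by norm_num)
    calc _ ≤ (2 : ℝ) ^ k * (2 ^ k * ((2 ^ k) ^ 3 * η * N ^ 2)) := by gcongr
      _ = (2 ^ k) ^ 5 * η * N ^ 2 := by ring
      _ ≤ _ := by gcongr
  linarith

lemma sum_inner'_upSq_lowES_le {μ : (∀ i, V i) → ℝ} {η : ℝ} (hμ : IsProb μ) (hη : 0 ≤ η)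
    (hC : AlmostCommute μ η) (m : ℕ) (f : (∀ i, V i) → ℝ) :
    ∑ B : Finset (Fin k), inner' μ (upSq (lowES μ m f) B) 1 ≤
      2 ^ m * ((1 + (2 ^ k) ^ 4 * η) * l2norm μ f ^ 2) := by
  have h1 : inner' μ 1 (∑ B ∈ univ.filter (fun T : Finset (Fin k) => ∅ ⊆ T),
      upSq (lowES μ m f) B) ≤ inner' μ 1 ((2 : ℝ) ^ m • upSq (fun S => ES μ S f) ∅) := by
    refine inner'_mono_right hμ (fun _ => zero_le_one) fun x _ =>
      (sum_upSq_le (lowES_eq_zero μ f) ∅ x).trans ?_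
    exact mul_le_mul_of_nonneg_left (upSq_lowES_le μ m f ∅ x) (by positivity)
  have h2 : inner' μ 1 (upSq (fun S => ES μ S f) ∅) =
      ∑ S : Finset (Fin k), l2norm μ (ES μ S f) ^ 2 := by
    simp only [upSq, inner'_sum_right, Finset.empty_subset, Finset.filter_true]
    refine Finset.sum_congr rfl fun S _ => ?_
    rw [l2norm_sq hμ, sq, inner'_comm, inner'_mul_left, mul_one]
  rw [inner'_sum_right, inner'_smul_right, h2] at h1
  simp only [Finset.empty_subset, Finset.filter_true] at h1
  simp only [inner'_comm μ _ 1]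
  refine h1.trans (mul_le_mul_of_nonneg_left ?_ (by positivity))
  have := (abs_le.1 (abs_l2norm_sq_sub_sum_ES_le hμ hη hC f)).1
  linarith

/-- The low-degree part of a global Boolean function has small fourth moment. -/
theorem norm_sq_sum_lowES_le {μ : (∀ i, V i) → ℝ} {η : ℝ} (hμ : IsProb μ) (hη : 0 ≤ η)
    (hη1 : η ≤ 1) (hC : AlmostCommute μ η) {d m : ℕ} (hm : m ≤ d) (hmk : m ≤ k) {δ : ℝ}
    (hδ : 0 ≤ δ) {f : (∀ i, V i) → ℝ} (hf : ∀ x, f x = 0 ∨ f x = 1) (hG : IsGlobal μ d δ f) :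
    l2norm μ ((∑ S, lowES μ m f S) * (∑ S, lowES μ m f S)) ^ 2 ≤
      (2 * 8192 ^ m * δ ^ 2 * (1 + (2 ^ k) ^ 4 * η) + 11 * (2 ^ k) ^ 18 * η) *
        l2norm μ f ^ 2 := by
  have hM : (1 : ℝ) ≤ 2 ^ k := one_le_pow₀ one_le_two
  have hf1 : ∀ x, |f x| ≤ 1 := fun x => by rcases hf x with h | h <;> simp [h]
  set N := l2norm μ f with hNdef
  have hN : 0 ≤ N := l2norm_nonneg μ f
  have h1 := (esFamily_lowES hμ hη hC hf1 m).norm_sq_sum_sq_le hμ hη hη1 hC hN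
  have h2 := sum_inner'_avg_upSq_le hμ (lowES_eq_zero μ (m := m) f)
  have h3 := Finset.sum_le_sum fun B (_ : B ∈ (univ : Finset (Finset (Fin k)))) =>
    inner'_avg_upSq_le hμ hη hC hm hδ hf hG B
  rw [Finset.sum_add_distrib, ← Finset.mul_sum, Finset.sum_const, nsmul_eq_mul,
    card_univ_finset] at h3
  have h4 := mul_le_mul_of_nonneg_left (sum_inner'_upSq_lowES_le hμ hη hC m f)
    (by positivity : (0 : ℝ) ≤ 4 ^ m * δ ^ 2)
  have h5 := mul_le_mul_of_nonneg_left (h3.trans (add_le_add_left h4 _))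
    (by positivity : (0 : ℝ) ≤ 1024 ^ m)
  have h6 : (1024 : ℝ) ^ m * (4 ^ m * δ ^ 2 * (2 ^ m * ((1 + (2 ^ k) ^ 4 * η) * N ^ 2))) =
      8192 ^ m * δ ^ 2 * (1 + (2 ^ k) ^ 4 * η) * N ^ 2 := by
    have : (8192 : ℝ) ^ m = 1024 ^ m * 4 ^ m * 2 ^ m := by
      rw [← mul_pow, ← mul_pow]; norm_num
    rw [this]; ring
  have h7 : (1024 : ℝ) ^ m * (2 ^ k * (2 * (2 ^ k) ^ 7 * η * N ^ 2)) ≤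
      2 * (2 ^ k) ^ 18 * η * N ^ 2 := by
    have h8 : (1024 : ℝ) ^ m ≤ (2 ^ k) ^ 10 := by
      rw [← pow_mul, mul_comm, pow_mul]
      norm_num
      exact pow_le_pow_right₀ (by norm_num) hmk
    calc _ ≤ (2 ^ k) ^ 10 * (2 ^ k * (2 * (2 ^ k) ^ 7 * η * N ^ 2)) := by gcongr
      _ = _ := by ring
  have h9 : 7 * (2 ^ k) ^ 15 * η * N ^ 2 ≤ 7 * (2 ^ k) ^ 18 * η * N ^ 2 := by
    have : ((2 : ℝ) ^ k) ^ 15 ≤ (2 ^ k) ^ 18 := pow_le_pow_right₀ hM (by norm_num)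
    gcongr
  rw [mul_add, h6] at h5
  linarith

/-! ### Expansion of the up-down walk -/

lemma inner'_sub_avg_erase_ge {μ : (∀ i, V i) → ℝ} {η : ℝ} (hμ : IsProb μ) (hη : 0 ≤ η)
    (hC : AlmostCommute μ η) (f : (∀ i, V i) → ℝ) (i : Fin k) :
    ∑ S : Finset (Fin k),
        (if i ∈ S then inner' μ (ES μ S f) f - 2 ^ k * η * l2norm μ f ^ 2 else 0) ≤
      inner' μ (f - avg μ (univ.erase i) f) f := by
  have e : inner' μ (f - avg μ (univ.erase i) f) f =
      ∑ S : Finset (Fin k), inner' μ (ES μ S f - avg μ (univ.erase i) (ES μ S f)) f := by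
    rw [← inner'_sum_left, Finset.sum_sub_distrib, ← map_sum, inner'_sub_left, inner'_sub_left,
      avg_congr (univ.erase i) fun x hx => sum_ES hμ f hx,
      inner'_comm μ (∑ S : Finset (Fin k), ES μ S f),
      inner'_congr_right f fun x hx => sum_ES hμ f hx]
  rw [e]
  refine Finset.sum_le_sum fun S _ => ?_
  split_ifs with hi
  · rw [inner'_sub_left]
    have h1 := (le_abs_self _).trans (abs_inner'_le hμ (avg μ (univ.erase i) (ES μ S f)) f)
    have h2 := mul_le_mul_of_nonneg_right (l2norm_avg_erase_ES_le hμ hη hC hi f)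
      (l2norm_nonneg μ f)
    linarith
  · have hj : Junta (univ.erase i) (ES μ S f) := (junta_ES μ S f).mono fun j hj =>
      Finset.mem_erase.2 ⟨by rintro rfl; exact hi hj, Finset.mem_univ j⟩
    rw [inner'_sub_left, inner'_comm, inner'_comm μ (avg μ (univ.erase i) (ES μ S f)),
      inner'_congr_right f fun x hx => avg_of_junta hμ hj hx, sub_self]

lemma sum_inner'_sub_avg_erase_ge {μ : (∀ i, V i) → ℝ} {η : ℝ} (hμ : IsProb μ) (hη : 0 ≤ η)
    (hC : AlmostCommute μ η) (f : (∀ i, V i) → ℝ) (m : ℕ) :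
    (m + 1) * (l2norm μ f ^ 2 - inner' μ (∑ S, lowES μ m f S) f) -
        2 * k * (2 ^ k) ^ 4 * η * l2norm μ f ^ 2 ≤
      ∑ i, inner' μ (f - avg μ (univ.erase i) f) f := by
  have hM : (1 : ℝ) ≤ 2 ^ k := one_le_pow₀ one_le_two
  set N := l2norm μ f with hN
  set c : Finset (Fin k) → ℝ := fun S => inner' μ (ES μ S f) f with hc
  refine le_trans ?_ (Finset.sum_le_sum fun i _ => inner'_sub_avg_erase_ge hμ hη hC f i)
  rw [Finset.sum_comm]
  have e1 : ∀ S : Finset (Fin k), ∑ i, (if i ∈ S then c S - 2 ^ k * η * N ^ 2 else 0) =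
      S.card * (c S - 2 ^ k * η * N ^ 2) := fun S => by
    rw [← Finset.sum_filter, Finset.sum_const, nsmul_eq_mul]
    simp
  have e2 : l2norm μ f ^ 2 - inner' μ (∑ S, lowES μ m f S) f =
      ∑ S : Finset (Fin k), if S.card ≤ m then 0 else c S := by
    have : l2norm μ f ^ 2 = ∑ S : Finset (Fin k), c S := by
      rw [l2norm_sq hμ, hc, ← inner'_sum_left, inner'_comm μ (∑ S : Finset (Fin k), ES μ S f)]
      exact (inner'_congr_right f fun x hx => sum_ES hμ f hx).symm
    rw [this, inner'_sum_left, ← Finset.sum_sub_distrib]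
    refine Finset.sum_congr rfl fun S _ => ?_
    unfold lowES
    split_ifs
    · exact sub_self _
    · simp [inner', hc]
  have h1 : ∀ S : Finset (Fin k), (m + 1) * (if S.card ≤ m then 0 else c S) -
      2 * k * (2 ^ k) ^ 3 * η * N ^ 2 ≤ S.card * (c S - 2 ^ k * η * N ^ 2) := fun S => by
    have h2 := (abs_le.1 (abs_inner'_ES_self_sub_le hμ hη hC S f)).1
    have h3 : 0 ≤ c S + (2 ^ k) ^ 3 * η * N ^ 2 := by
      have := sq_nonneg (l2norm μ (ES μ S f))
      simp only [hc]
      linarith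
    have h4 : (S.card : ℝ) ≤ k := by exact_mod_cast (Finset.card_le_univ S).trans (by simp)
    have h5 : (2 : ℝ) ^ k * η * N ^ 2 ≤ (2 ^ k) ^ 3 * η * N ^ 2 := by
      have : (2 : ℝ) ^ k ≤ (2 ^ k) ^ 3 := le_self_pow₀ hM (by norm_num)
      gcongr
    have h6 : 0 ≤ (2 ^ k) ^ 3 * η * N ^ 2 := by positivity
    have h7 : (S.card : ℝ) * ((2 ^ k) ^ 3 * η * N ^ 2 + 2 ^ k * η * N ^ 2) ≤
        k * (2 * ((2 ^ k) ^ 3 * η * N ^ 2)) := by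
      refine mul_le_mul h4 (by linarith) (by positivity) (by positivity)
    have h8 : (m + 1) * (if S.card ≤ m then 0 else c S) ≤
        S.card * (c S + (2 ^ k) ^ 3 * η * N ^ 2) := by
      split_ifs with h
      · rw [mul_zero]; positivity
      · have h9 : ((m : ℝ) + 1) ≤ S.card := by exact_mod_cast not_le.1 h
        calc _ ≤ ((m : ℝ) + 1) * (c S + (2 ^ k) ^ 3 * η * N ^ 2) := by gcongr; linarith
          _ ≤ _ := mul_le_mul_of_nonneg_right h9 h3
    linarith
  rw [e2]
  refine le_trans (le_of_eq ?_)
    (Finset.sum_le_sum fun S _ => (h1 S).trans (le_of_eq (e1 S).symm))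
  rw [Finset.sum_sub_distrib, ← Finset.mul_sum, Finset.sum_const, nsmul_eq_mul, card_univ_finset]
  ring

lemma inner'_le_of_norm_sq_le {μ : (∀ i, V i) → ℝ} (hμ : IsProb μ) {f g : (∀ i, V i) → ℝ}
    (hf : ∀ x, f x = 0 ∨ f x = 1) {θ : ℝ} (hθ : 0 ≤ θ)
    (h : l2norm μ (g * g) ^ 2 ≤ θ ^ 4 * l2norm μ f ^ 2) :
    inner' μ g f ≤ θ * l2norm μ f ^ 2 := by
  have hN := l2norm_nonneg μ f
  have hff : f * f = f := by
    ext y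
    rcases hf y with h | h <;> simp [h]
  have h1 : l2norm μ (g * g) ≤ θ ^ 2 * l2norm μ f :=
    le_of_sq_le_sq (by linarith) (by positivity)
  have h2 : l2norm μ (g * f) ^ 2 = inner' μ (g * g) f := by
    rw [l2norm_sq hμ, inner'_mul_left, inner'_mul_left]
    congr 1
    rw [← mul_assoc, mul_comm f g, mul_assoc, hff]
  have h3 := (le_abs_self _).trans (abs_inner'_le hμ (g * g) f)
  have h4 : l2norm μ (g * f) ≤ θ * l2norm μ f := by
    refine le_of_sq_le_sq ?_ (by positivity)
    have := mul_le_mul_of_nonneg_right h1 hN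
    linarith
  have h5 : inner' μ g f = inner' μ (g * f) f := by rw [inner'_mul_left, hff]
  have h6 := (le_abs_self _).trans (abs_inner'_le hμ (g * f) f)
  have h7 := mul_le_mul_of_nonneg_right h4 hN
  rw [h5]
  linarith

lemma eight_mul_le_one_of_le_inv {d m : ℕ} (hd : 1 ≤ d) (hm : m ≤ d) {δ : ℝ} (hδ0 : 0 ≤ δ)
    (hδ : δ ≤ ((200 * (d : ℝ)) ^ (2 * d))⁻¹) :
    8 * 8192 ^ m * δ ^ 2 * (d + 1 : ℝ) ^ 4 ≤ 1 := by
  have hd1 : (1 : ℝ) ≤ d := by exact_mod_cast hd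
  have h1 : δ ^ 2 ≤ ((200 * (d : ℝ)) ^ (4 * d))⁻¹ := by
    refine (pow_le_pow_left₀ hδ0 hδ 2).trans (le_of_eq ?_)
    rw [inv_pow, ← pow_mul]
    congr 2
    ring
  have h2 : (8 : ℝ) * 8192 ^ m * (d + 1 : ℝ) ^ 4 ≤ (200 * (d : ℝ)) ^ (4 * d) := by
    have h3 : (8192 : ℝ) ^ m ≤ 8192 ^ d := pow_le_pow_right₀ (by norm_num) hm
    have h4 : ((d : ℝ) + 1) ^ 4 ≤ (2 * d) ^ 4 := pow_le_pow_left₀ (by positivity) (by linarith) 4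
    have h5 : (d : ℝ) ^ 4 ≤ (d ^ 4) ^ d := le_self_pow₀ (one_le_pow₀ hd1) (by omega)
    have h6 : (128 : ℝ) ≤ 128 ^ d := le_self_pow₀ (by norm_num) (by omega)
    calc (8 : ℝ) * 8192 ^ m * (d + 1 : ℝ) ^ 4 ≤
          (8 : ℝ) * 8192 ^ d * (2 * (d : ℝ)) ^ 4 := by gcongr
      _ = (128 : ℝ) * 8192 ^ d * (d : ℝ) ^ 4 := by ring
      _ ≤ (128 : ℝ) ^ d * 8192 ^ d * ((d : ℝ) ^ 4) ^ d := by gcongr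
      _ = (1048576 * (d : ℝ) ^ 4) ^ d := by rw [← mul_pow, ← mul_pow]; norm_num
      _ ≤ ((200 * (d : ℝ)) ^ 4) ^ d := by
          refine pow_le_pow_left₀ (by positivity) ?_ d
          rw [mul_pow]
          gcongr
          norm_num
      _ = _ := (pow_mul _ _ _).symm
  calc 8 * 8192 ^ m * δ ^ 2 * (d + 1 : ℝ) ^ 4 = 8 * 8192 ^ m * (d + 1 : ℝ) ^ 4 * δ ^ 2 := by ring
    _ ≤ (200 * (d : ℝ)) ^ (4 * d) * ((200 * (d : ℝ)) ^ (4 * d))⁻¹ := by gcongr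
    _ = 1 := mul_inv_cancel₀ (by positivity)

lemma inner'_sub_avg_nonneg {μ : (∀ i, V i) → ℝ} (hμ : IsProb μ) (S : Finset (Fin k))
    (f : (∀ i, V i) → ℝ) : 0 ≤ inner' μ (f - avg μ S f) f := by
  have h1 : l2norm μ (avg μ S f) ^ 2 = inner' μ (avg μ S f) f := by
    rw [l2norm_sq hμ, inner'_avg_eq hμ]
  have h2 := pow_le_pow_left₀ (l2norm_nonneg _ _) (l2norm_avg_le hμ S f) 2
  rw [inner'_sub_left, ← h1, ← l2norm_sq hμ]
  linarith

lemma inner'_sub_upDown (hk : 1 ≤ k) (μ f : (∀ i, V i) → ℝ) :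
    inner' μ (fun x => f x - upDown μ f x) f =
      1 / k * ∑ i, inner' μ (f - avg μ (univ.erase i) f) f := by
  have hk0 : (k : ℝ) ≠ 0 := by positivity
  have e : (fun x => f x - upDown μ f x) =
      (1 / k : ℝ) • ∑ i, (f - avg μ (univ.erase i) f) := by
    ext x
    rw [Pi.smul_apply, Finset.sum_sub_distrib, Finset.sum_const, Finset.card_univ,
      Fintype.card_fin, Pi.sub_apply, smul_eq_mul, Finset.sum_apply, mul_sub, Pi.smul_apply,
      nsmul_eq_mul, ← mul_assoc, one_div_mul_cancel hk0, one_mul]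
    rfl
  rw [e, inner'_smul_left, inner'_sum_left]

theorem inner'_sub_upDown_ge (hk : 1 ≤ k) {μ : (∀ i, V i) → ℝ} {ε δ : ℝ} {d : ℕ}
    {f : (∀ i, V i) → ℝ} (hε : 0 ≤ ε) (hε1 : 44 * k ^ 2 * (2 ^ k) ^ 18 * (k + 1) ^ 4 * ε ≤ 1)
    (hμ : IsProb μ) (hE : EpsProduct μ ε) (hd : d ≤ k) (hδ0 : 0 ≤ δ)
    (hδ : δ ≤ ((200 * (d : ℝ)) ^ (2 * d))⁻¹) (hf : ∀ x, f x = 0 ∨ f x = 1)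
    (hG : IsGlobal μ d δ f) :
    ((d : ℝ) / (2 * k)) * normSq μ f - 4 * k ^ 2 * (2 ^ k) ^ 4 * ε * normSq μ f ≤
      inner' μ (fun x => f x - upDown μ f x) f := by
  have hM : (1 : ℝ) ≤ 2 ^ k := one_le_pow₀ one_le_two
  have hk1 : (1 : ℝ) ≤ k := by exact_mod_cast hk
  have hn := normSq_nonneg hμ f
  rw [inner'_sub_upDown hk]
  rcases Nat.eq_zero_or_pos d with rfl | hd0
  · have h1 : 0 ≤ ∑ i, inner' μ (f - avg μ (univ.erase i) f) f :=
      Finset.sum_nonneg fun i _ => inner'_sub_avg_nonneg hμ _ f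
    have h2 : 0 ≤ 1 / (k : ℝ) * ∑ i, inner' μ (f - avg μ (univ.erase i) f) f := by positivity
    have h3 : 0 ≤ 4 * k ^ 2 * (2 ^ k) ^ 4 * ε * normSq μ f := by positivity
    simp only [CharP.cast_eq_zero, zero_div, zero_mul]
    linarith
  have hC := EpsProduct.almostCommute hμ hε hE
  set η : ℝ := 2 * k ^ 2 * ε with hηdef
  have hη : 0 ≤ η := by positivity
  have hη1 : 22 * (2 ^ k) ^ 18 * (k + 1) ^ 4 * η ≤ 1 := by
    rw [hηdef]; linarith
  have hk4 : (1 : ℝ) ≤ (k + 1) ^ 4 := one_le_pow₀ (by linarith)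
  have hη2 : (2 ^ k) ^ 4 * η ≤ 1 := by
    have h1 : ((2 : ℝ) ^ k) ^ 4 ≤ (2 ^ k) ^ 18 := pow_le_pow_right₀ hM (by norm_num)
    calc ((2 : ℝ) ^ k) ^ 4 * η = 1 * (2 ^ k) ^ 4 * 1 * η := by ring
      _ ≤ 22 * (2 ^ k) ^ 18 * (k + 1) ^ 4 * η := by gcongr; norm_num
      _ ≤ 1 := hη1
  have hη3 : η ≤ 1 := by
    have h1 : (1 : ℝ) ≤ (2 ^ k) ^ 4 := one_le_pow₀ hM
    nlinarith
  have hd1 : (0 : ℝ) < d + 1 := by positivity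
  have hmd : d / 2 ≤ d := Nat.div_le_self d 2
  have hX := norm_sq_sum_lowES_le hμ hη hη3 hC hmd (hmd.trans hd) hδ0 hf hG
  have hN : l2norm μ f ^ 2 = normSq μ f := by rw [l2norm_sq hμ, normSq_eq_inner']
  have hθ : 2 * 8192 ^ (d / 2) * δ ^ 2 * (1 + (2 ^ k) ^ 4 * η) + 11 * (2 ^ k) ^ 18 * η ≤
      (1 / (d + 1 : ℝ)) ^ 4 := by
    rw [div_pow, one_pow, le_div_iff₀ (by positivity), add_mul]
    have h1 := eight_mul_le_one_of_le_inv hd0 hmd hδ0 hδ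
    have h2 : 2 * 8192 ^ (d / 2) * δ ^ 2 * (1 + (2 ^ k) ^ 4 * η) * (d + 1 : ℝ) ^ 4 ≤
        2 * 8192 ^ (d / 2) * δ ^ 2 * (1 + 1) * (d + 1 : ℝ) ^ 4 := by gcongr
    have h3 : 11 * (2 ^ k) ^ 18 * η * (d + 1 : ℝ) ^ 4 ≤
        11 * (2 ^ k) ^ 18 * η * (k + 1 : ℝ) ^ 4 := by gcongr
    linarith
  have hgf := inner'_le_of_norm_sq_le hμ hf (by positivity : (0 : ℝ) ≤ 1 / (d + 1))
    (hX.trans (mul_le_mul_of_nonneg_right hθ (sq_nonneg _)))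
  have hsum := sum_inner'_sub_avg_erase_ge hμ hη hC f (d / 2)
  rw [hN] at hgf hsum
  have hm : ((d : ℝ) + 1) ≤ 2 * ((d / 2 : ℕ) + 1) := by
    have : d + 1 ≤ 2 * (d / 2 + 1) := by omega
    exact_mod_cast this
  have h1 : (d : ℝ) / 2 * normSq μ f ≤ ((d / 2 : ℕ) + 1) *
      (normSq μ f - inner' μ (∑ S, lowES μ (d / 2) f S) f) := by
    have h2 : (d : ℝ) / (d + 1) * normSq μ f ≤
        normSq μ f - inner' μ (∑ S, lowES μ (d / 2) f S) f := by
      have : (d : ℝ) / (d + 1) = 1 - 1 / (d + 1) := by field_simp; ring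
      rw [this]
      linarith
    calc (d : ℝ) / 2 * normSq μ f = ((d + 1) / 2) * ((d : ℝ) / (d + 1) * normSq μ f) := by
          field_simp
      _ ≤ ((d / 2 : ℕ) + 1) * ((d : ℝ) / (d + 1) * normSq μ f) := by
          gcongr
          linarith
      _ ≤ _ := by gcongr
  calc (d : ℝ) / (2 * k) * normSq μ f - 4 * k ^ 2 * (2 ^ k) ^ 4 * ε * normSq μ f =
        1 / k * ((d : ℝ) / 2 * normSq μ f - 2 * k * (2 ^ k) ^ 4 * η * normSq μ f) := by
        rw [hηdef]
        field_simp
        ring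
    _ ≤ _ := by
        gcongr
        linarith

theorem statement4 (k : ℕ) (hk : 1 ≤ k) :
    ∃ ε₀ C : ℝ, 0 < ε₀ ∧ 0 < C ∧
      ∀ (V : Fin k → Type) [∀ i, Fintype (V i)] [∀ i, DecidableEq (V i)]
        (μ : (∀ i, V i) → ℝ) (ε δ : ℝ) (d : ℕ) (f : (∀ i, V i) → ℝ),
        0 < ε → ε ≤ ε₀ → IsProb μ → EpsProduct μ ε → d ≤ k →
        0 < δ → δ ≤ ((200 * (d : ℝ)) ^ (2 * d))⁻¹ →
        (∀ x, f x = 0 ∨ f x = 1) → IsGlobal μ d δ f →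
        inner' μ (fun x => f x - upDown μ f x) f ≥
          ((d : ℝ) / (2 * k)) * normSq μ f - C * Real.sqrt ε * normSq μ f := by
  have hk1 : (1 : ℝ) ≤ k := by exact_mod_cast hk
  have hA : 0 < (44 : ℝ) * k ^ 2 * (2 ^ k) ^ 18 * (k + 1) ^ 4 := by positivity
  refine ⟨(44 * (k : ℝ) ^ 2 * (2 ^ k) ^ 18 * (k + 1) ^ 4)⁻¹, 4 * k ^ 2 * (2 ^ k) ^ 4,
    inv_pos.2 hA, by positivity, ?_⟩
  intro V _ _ μ ε δ d f hε hε₀ hμ hE hd hδ0 hδ hf hG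
  have h1 : 44 * k ^ 2 * (2 ^ k) ^ 18 * (k + 1) ^ 4 * ε ≤ 1 := by
    calc _ ≤ 44 * (k : ℝ) ^ 2 * (2 ^ k) ^ 18 * (k + 1) ^ 4 *
          (44 * (k : ℝ) ^ 2 * (2 ^ k) ^ 18 * (k + 1) ^ 4)⁻¹ := by gcongr
      _ = 1 := mul_inv_cancel₀ hA.ne'
  have h2 := inner'_sub_upDown_ge hk hε.le h1 hμ hE hd hδ0.le hδ hf hG
  have hA1 : (1 : ℝ) ≤ 44 * k ^ 2 * (2 ^ k) ^ 18 * (k + 1) ^ 4 := by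
    have h3 : (1 : ℝ) ≤ k ^ 2 := one_le_pow₀ hk1
    have h4 : (1 : ℝ) ≤ (2 ^ k) ^ 18 := one_le_pow₀ (one_le_pow₀ one_le_two)
    have h5 : (1 : ℝ) ≤ (k + 1) ^ 4 := one_le_pow₀ (by linarith)
    calc (1 : ℝ) = 1 * 1 * 1 * 1 := by norm_num
      _ ≤ _ := by gcongr; norm_num
  have hε1 : ε ≤ 1 := by nlinarith
  have hs : ε ≤ Real.sqrt ε := by
    refine Real.le_sqrt_of_sq_le ?_
    nlinarith
  have hn := normSq_nonneg hμ f
  have h6 : 4 * k ^ 2 * (2 ^ k) ^ 4 * ε * normSq μ f ≤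
      4 * k ^ 2 * (2 ^ k) ^ 4 * Real.sqrt ε * normSq μ f := by gcongr
  linarith

end GLL
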